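/- Let F be a Henselian valued field, I and D finite-dimensional central division algebras over F with I inertial and D tame, and let D' be the division algebra underlying the Brauer class \([I\otimes_F D]\). Then \(Z(\overline{D'})\cong Z(\overline{D})\), \(\Gamma_{D'}=\Gamma_D\), \([\overline{D'}]=[\overline{I}\otimes_{\overline{F}}\overline{D}]\) in \(\operatorname{Br}(Z(\overline{D}))\), and \(\deg D/\deg\overline{D}=\deg D'/\deg\overline{D'}\). -/

import Mathlib

noncomputable section

namespace ValuedDivPaper

/-- `K` is a (commutative) subfield of the subring `A` of an ambient ring. -/
def IsSubfieldOf {R : Type*} [Ring R] (A K : Subring R) : Prop :=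
  K ≤ A ∧ (∀ x ∈ K, ∀ y ∈ K, x * y = y * x) ∧
    ∀ x ∈ K, x ≠ 0 → ∃ y ∈ K, x * y = 1 ∧ y * x = 1

/-- `[R : S]`: the rank of the ring `R` as a module over a subring `S`. -/
def dimOver {R : Type*} [Ring R] (S : Subring R) : ℕ := Module.finrank S R

/-- `[A : B]`: the rank of a subring `A` of `R` over a subring `B`. -/
def relDim {R : Type*} [Ring R] (B A : Subring R) : ℕ :=
  Module.finrank (B.comap A.subtype) A

/-- `L/F` is a Galois extension (of subrings of an ambient ring): `F ≤ L` and `F` is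
exactly the fixed ring of the group of ring automorphisms of `L` fixing `F` pointwise. -/
def IsGaloisExt {R : Type*} [Ring R] (F L : Subring R) : Prop :=
  F ≤ L ∧ ∀ x : L,
    (∀ σ : L ≃+* L, (∀ y : L, (y : R) ∈ F → σ y = y) → σ x = x) → (x : R) ∈ F

/-- `p` is the minimal polynomial of `c` over the subring `F`. -/
def IsMinPolyOf {R : Type*} [Ring R] (F : Subring R) (c : R) (p : Polynomial F) : Prop :=
  p.Monic ∧ Polynomial.eval₂ F.subtype c p = 0 ∧
    ∀ q : Polynomial F, q.Monic → Polynomial.eval₂ F.subtype c q = 0 → p.degree ≤ q.degree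

/-- The polynomial `p` over `F` splits into linear factors over `L`. -/
def SplitsIn {R : Type*} [Ring R] {F L : Subring R} (h : F ≤ L) (p : Polynomial F) : Prop :=
  ∃ s : List L,
    p.map (Subring.inclusion h) = (s.map fun a => Polynomial.X - Polynomial.C a).prod

/-- `L/F` is a normal extension: the minimal polynomial over `F` of every element of `L`
splits over `L`. -/
def IsNormalExt {R : Type*} [Ring R] (F L : Subring R) : Prop :=
  ∃ h : F ≤ L, ∀ c ∈ L, ∀ p : Polynomial F, IsMinPolyOf F c p → SplitsIn h p

variable {Γ₀ : Type*} [LinearOrderedCommGroupWithZero Γ₀]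

/-- The value set `Γ_R = w(R ∖ {0})` of a valuation. -/
def valueSet {R : Type*} [Ring R] (w : Valuation R Γ₀) : Set Γ₀ :=
  {g : Γ₀ | ∃ x : R, x ≠ 0 ∧ w x = g}

/-- The value set `Γ_M = w(M ∖ {0})` of a subring `M`. -/
def valueSetOn {R : Type*} [Ring R] (w : Valuation R Γ₀) (M : Subring R) : Set Γ₀ :=
  {g : Γ₀ | ∃ x ∈ M, x ≠ 0 ∧ w x = g}

/-- The index `|A : B|` of subsets of the (multiplicative) value monoid: the number of
classes of `A` modulo multiplicative translation by `B`. -/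
def mulSetIndex (A B : Set Γ₀) : ℕ :=
  Nat.card (Quot (fun x y : A => ∃ b ∈ B, (x : Γ₀) = (y : Γ₀) * b))

/-- Residue data for a valued division ring: a surjection `π` from the valuation ring
onto `Rbar` whose kernel is the maximal ideal, exhibiting `Rbar` as the residue ring. -/
structure ResidueData {R : Type*} [Ring R] (w : Valuation R Γ₀) (Rbar : Type*) [Ring Rbar] where
  π : w.integer →+* Rbar
  surj : Function.Surjective π
  ker : ∀ x : w.integer, π x = 0 ↔ w (x : R) < 1

/-- Compatibility of the residue data of `D` with the residue data of `F ⊆ D`: the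
embedding `F̄ → D̄` (given by the algebra map) commutes with taking residues. -/
def ResCompat {Γ₀' : Type*} [LinearOrderedCommGroupWithZero Γ₀']
    {F : Type*} [Field F] {D : Type*} [DivisionRing D] [Algebra F D]
    (v : Valuation F Γ₀) (w : Valuation D Γ₀')
    {Fbar : Type*} [Field Fbar] {Dbar : Type*} [DivisionRing Dbar] [Algebra Fbar Dbar]
    (rF : ResidueData v Fbar) (rD : ResidueData w Dbar) : Prop :=
  ∀ (x : F) (hx : x ∈ v.integer) (hx' : algebraMap F D x ∈ w.integer),
    algebraMap Fbar Dbar (rF.π ⟨x, hx⟩) = rD.π ⟨algebraMap F D x, hx'⟩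

/-- The kernel of the canonical homomorphism
`θ_D : Γ_D → Gal(Z(D̄)/F̄)` induced by conjugation: the set of values `g ∈ Γ_D` such
that conjugation by any element of value `g` is trivial on the center of `D̄`. -/
def kerTheta {D : Type*} [DivisionRing D] (w : Valuation D Γ₀)
    {Dbar : Type*} [DivisionRing Dbar] (rD : ResidueData w Dbar) : Set Γ₀ :=
  {g : Γ₀ | (∃ x : D, x ≠ 0 ∧ w x = g) ∧
    ∀ x : D, x ≠ 0 → w x = g →
      ∀ z : w.integer, rD.π z ∈ Subring.center Dbar →
        ∀ (h : x * (z : D) * x⁻¹ ∈ w.integer), rD.π ⟨x * (z : D) * x⁻¹, h⟩ = rD.π z}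

/-- The center `Z(D̄)` of the residue division ring is separable over the residue
field `F̄` (elementwise: each central element is annihilated by a monic separable
polynomial over `F̄`). -/
def CenterResidueSeparable (Fbar : Type*) [Field Fbar]
    (Dbar : Type*) [DivisionRing Dbar] [Algebra Fbar Dbar] : Prop :=
  ∀ z ∈ Subring.center Dbar, ∃ p : Polynomial Fbar,
    p.Monic ∧ p.Separable ∧ Polynomial.eval₂ (algebraMap Fbar Dbar) z p = 0

/-- `D` is tame (tamely ramified) over `F`:
`[D : F] = [D̄ : F̄]⬝|Γ_D : Γ_F|` (defectlessness), `Z(D̄)/F̄` is separable, and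
`char F̄` does not divide `|ker θ_D : Γ_F|`. -/
def IsTame (F : Type*) [Field F] {D : Type*} [DivisionRing D] [Algebra F D]
    (w : Valuation D Γ₀)
    (Fbar : Type*) [Field Fbar] {Dbar : Type*} [DivisionRing Dbar] [Algebra Fbar Dbar]
    (rD : ResidueData w Dbar) : Prop :=
  Module.finrank F D =
      Module.finrank Fbar Dbar *
        mulSetIndex (valueSet w) (valueSetOn w (algebraMap F D).range) ∧
    CenterResidueSeparable Fbar Dbar ∧
    ¬ (ringChar Fbar ∣ mulSetIndex (kerTheta w rD) (valueSetOn w (algebraMap F D).range))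

/-- `I` is inertial over `F`: tame and unramified (`Γ_I = Γ_F`). -/
def IsInertial (F : Type*) [Field F] {I : Type*} [DivisionRing I] [Algebra F I]
    (w : Valuation I Γ₀)
    (Fbar : Type*) [Field Fbar] {Ibar : Type*} [DivisionRing Ibar] [Algebra Fbar Ibar]
    (rI : ResidueData w Ibar) : Prop :=
  IsTame F w Fbar rI ∧ valueSet w = valueSetOn w (algebraMap F I).range

/-- `M` is a maximal subfield of the division algebra `D` over its center `F`:
a commutative subfield containing `F` with `[M : F] = deg D`, i.e.
`[M : F]² = [D : F]`. -/
def IsMaxSubfieldDeg (F : Type*) [Field F] {D : Type*} [DivisionRing D] [Algebra F D]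
    (M : Subring D) : Prop :=
  IsSubfieldOf ⊤ M ∧ (algebraMap F D).range ≤ M ∧
    relDim (algebraMap F D).range M ^ 2 = Module.finrank F D

/-- `N` is a maximal subfield of the division ring `Dbar`: a commutative subfield
containing the center with `[N : Z(D̄)] = deg D̄`, i.e. `[N : Z(D̄)]² = [D̄ : Z(D̄)]`. -/
def IsMaxSubfieldCenterDeg {Dbar : Type*} [DivisionRing Dbar] (N : Subring Dbar) : Prop :=
  IsSubfieldOf ⊤ N ∧ Subring.center Dbar ≤ N ∧
    relDim (Subring.center Dbar) N ^ 2 = dimOver (Subring.center Dbar)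

/-- The residue (sub)ring of a subring `M ⊆ D` in the residue division ring `D̄`. -/
def residueOf {D : Type*} [DivisionRing D] (w : Valuation D Γ₀)
    {Dbar : Type*} [DivisionRing Dbar] (rD : ResidueData w Dbar) (M : Subring D) :
    Subring Dbar :=
  (M.comap w.integer.subtype).map rD.π

/-- The subfield `M` of `D` is tamely ramified over `F`: its residue extension over `F̄`
is separable and its ramification index over `F` is prime to `char F̄`. -/
def IsTamelyRamifiedSubfield (F : Type*) [Field F] {D : Type*} [DivisionRing D]
    [Algebra F D] (w : Valuation D Γ₀)
    (Fbar : Type*) [Field Fbar] {Dbar : Type*} [DivisionRing Dbar] [Algebra Fbar Dbar]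
    (rD : ResidueData w Dbar) (M : Subring D) : Prop :=
  (∀ z ∈ residueOf w rD M, ∃ p : Polynomial Fbar,
      p.Monic ∧ p.Separable ∧ Polynomial.eval₂ (algebraMap Fbar Dbar) z p = 0) ∧
    ¬ (ringChar Fbar ∣
        mulSetIndex (valueSetOn w M) (valueSetOn w (algebraMap F D).range))

end ValuedDivPaper

namespace ValuedDivPaper

open Polynomial

section Henselian

variable {L Γ' : Type*} [Field L] [LinearOrderedCommGroupWithZero Γ'] (w : Valuation L Γ')

theorem coeff_prod_X_sub_C_le_one (s : Multiset L) (hs : ∀ r ∈ s, w r ≤ 1) (i : ℕ) :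
    w (((s.map fun r => X - C r).prod).coeff i) ≤ 1 := by
  induction s using Multiset.induction_on generalizing i with
  | empty =>
    simp only [Multiset.map_zero, Multiset.prod_zero, coeff_one]
    split_ifs <;> simp
  | cons r s ih =>
    have ih' := ih fun a ha => hs a (Multiset.mem_cons_of_mem ha)
    have hr : w r ≤ 1 := hs r (Multiset.mem_cons_self r s)
    rw [Multiset.map_cons, Multiset.prod_cons, sub_mul, coeff_sub, coeff_C_mul]
    refine w.map_sub_le ?_ ?_
    · cases i with
      | zero => simp
      | succ i => rw [coeff_X_mul]; exact ih' i
    · rw [map_mul]; exact mul_le_one' hr (ih' i)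

theorem coeff_prod_X_sub_C_lt_one (s : Multiset L) (hs : ∀ r ∈ s, w r < 1) (i : ℕ)
    (hi : i < Multiset.card s) : w (((s.map fun r => X - C r).prod).coeff i) < 1 := by
  induction s using Multiset.induction_on generalizing i with
  | empty => simp at hi
  | cons r s ih =>
    have hs' : ∀ a ∈ s, w a < 1 := fun a ha => hs a (Multiset.mem_cons_of_mem ha)
    have hr : w r < 1 := hs r (Multiset.mem_cons_self r s)
    have hle := coeff_prod_X_sub_C_le_one w s (fun a ha => (hs' a ha).le)
    rw [Multiset.map_cons, Multiset.prod_cons, sub_mul, coeff_sub, coeff_C_mul]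
    refine w.map_sub_lt ?_ ?_
    · cases i with
      | zero => simp
      | succ i =>
        rw [coeff_X_mul]
        exact ih hs' i (by simpa using hi)
    · rw [map_mul]
      exact mul_lt_one_of_lt_of_le hr (hle i)

theorem eval_le_one {p : L[X]} (hp : ∀ i, w (p.coeff i) ≤ 1) {x : L} (hx : w x ≤ 1) :
    w (p.eval x) ≤ 1 := by
  rw [eval_eq_sum_range]
  refine w.map_sum_le fun i _ => ?_
  rw [map_mul, map_pow]
  exact mul_le_one' (hp i) (pow_le_one' hx i)

variable {F Γ₀ : Type*} [Field F] [LinearOrderedCommGroupWithZero Γ₀] {v : Valuation F Γ₀}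
  [Algebra F L]

theorem map_lt_one_iff_of_le_one_iff (hw : ∀ x : F, w (algebraMap F L x) ≤ 1 ↔ v x ≤ 1) (x : F) :
    w (algebraMap F L x) < 1 ↔ v x < 1 := by
  rcases eq_or_ne x 0 with rfl | hx
  · simp
  have h := hw x⁻¹
  rw [map_inv₀, map_inv₀, map_inv₀] at h
  have h1 : 0 < w (algebraMap F L x) := by simpa [zero_lt_iff] using hx
  have h2 : 0 < v x := by simpa [zero_lt_iff] using hx
  rw [inv_le_one₀ h1, inv_le_one₀ h2] at h
  rw [← not_le, h, not_le]

/-- A Galois-closed element close to `1` all of whose other conjugates are small is rational. -/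
theorem mem_range_of_conjugates_small (hhens : HenselianLocalRing v.valuationSubring)
    [IsGalois F L] (hw : ∀ x : F, w (algebraMap F L x) ≤ 1 ↔ v x ≤ 1) (θ : L)
    (h1 : w (θ - 1) < 1) (hconj : ∀ σ : L ≃ₐ[F] L, σ θ = θ ∨ w (σ θ) < 1) :
    θ ∈ (algebraMap F L).range := by
  classical
  have hθint : IsIntegral F θ := Algebra.IsIntegral.isIntegral θ
  set m := minpoly F θ with hm
  have hirr : Irreducible m := minpoly.irreducible hθint
  have hsplit : (m.map (algebraMap F L)).Splits := Normal.splits inferInstance θ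
  have hmonic : (m.map (algebraMap F L)).Monic := (minpoly.monic hθint).map _
  have hsep : (m.map (algebraMap F L)).Separable :=
    Polynomial.Separable.map (show (minpoly F θ).Separable from Algebra.IsSeparable.isSeparable F θ)
  set s := (m.map (algebraMap F L)).roots with hs
  have hprod : m.map (algebraMap F L) = (s.map fun r => X - C r).prod :=
    hsplit.eq_prod_roots_of_monic hmonic
  have hnodup : s.Nodup := nodup_roots hsep
  have hθs : θ ∈ s := by
    rw [hs, mem_roots hmonic.ne_zero, IsRoot.def, eval_map_algebraMap]
    exact minpoly.aeval F θ
  have hθ1 : w θ = 1 := by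
    have := w.map_one_add_of_lt h1
    simpa using this
  have hcs : ∀ r ∈ s, r = θ ∨ w r < 1 := by
    intro r hr
    have hr' : aeval r (minpoly F θ) = 0 := by
      have := (mem_roots hmonic.ne_zero).1 hr
      rwa [IsRoot.def, eval_map_algebraMap] at this
    obtain ⟨σ, rfl⟩ := minpoly.exists_algEquiv_of_root' (Algebra.IsAlgebraic.isAlgebraic θ) hr'
    exact hconj σ
  have hcs' : ∀ r ∈ s, w r ≤ 1 := fun r hr => (hcs r hr).elim (fun h => by rw [h, hθ1]) le_of_lt
  obtain ⟨s', hs'⟩ := Multiset.exists_cons_of_mem hθs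
  have hs'1 : ∀ r ∈ s', w r < 1 := by
    intro r hr
    rw [hs', Multiset.nodup_cons] at hnodup
    refine (hcs r (by rw [hs']; exact Multiset.mem_cons_of_mem hr)).resolve_left ?_
    rintro rfl
    exact hnodup.1 hr
  set h := (s'.map fun r => X - C r).prod with hh
  have hmh : m.map (algebraMap F L) = (X - C θ) * h := by
    rw [hprod, hs', Multiset.map_cons, Multiset.prod_cons]
  have hhc := coeff_prod_X_sub_C_le_one w s' fun r hr => (hs'1 r hr).le
  have hh1 : w (h.eval 1) = 1 := by
    clear_value h
    subst hh
    clear hmh hhc hs'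
    induction s' using Multiset.induction_on with
    | empty => simp
    | cons r s' ih =>
      have hr : w (1 - r) = 1 := by
        exact w.map_one_sub_of_lt (hs'1 r (Multiset.mem_cons_self r s'))
      simp only [Multiset.map_cons, Multiset.prod_cons, eval_mul, eval_sub, eval_X, eval_C,
        map_mul, hr, one_mul]
      exact ih fun a ha => hs'1 a (Multiset.mem_cons_of_mem ha)
  have hcoeff : ∀ i, v (m.coeff i) ≤ 1 := by
    intro i
    rw [← hw, ← coeff_map, hprod]
    exact coeff_prod_X_sub_C_le_one w s hcs' i
  obtain ⟨m₀, hm₀, hm₀deg, hm₀monic⟩ : ∃ q : v.valuationSubring[X],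
      q.map (algebraMap v.valuationSubring F) = m ∧ q.degree = m.degree ∧ q.Monic := by
    refine lifts_and_degree_eq_and_monic ?_ (minpoly.monic hθint)
    rw [lifts_iff_coeff_lifts]
    exact fun i => ⟨⟨m.coeff i, hcoeff i⟩, rfl⟩
  have hmap : ∀ (q : v.valuationSubring[X]),
      w (algebraMap F L (q.eval 1 : v.valuationSubring)) =
        w (((q.map (algebraMap v.valuationSubring F)).map (algebraMap F L)).eval 1) := by
    intro q
    have : ((q.eval 1 : v.valuationSubring) : F) =
      (q.map (algebraMap v.valuationSubring F)).eval 1 := by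
        rw [eval_one_map]; rfl
    rw [this, eval_one_map, eval_one_map, eval_one_map]
  have hu : ∀ x : v.valuationSubring, IsUnit x ↔ w (algebraMap F L x) = 1 := by
    intro x
    have hx1 : IsUnit x ↔ v (x : F) = 1 :=
      (Valuation.integer.integers v).isUnit_iff_valuation_eq_one (x := x)
    have hx2 : v (x : F) ≤ 1 := x.2
    have hx3 := map_lt_one_iff_of_le_one_iff w hw (x : F)
    have hx4 : w (algebraMap F L (x : F)) ≤ 1 := (hw _).2 hx2
    rw [hx1]
    constructor
    · intro h
      exact le_antisymm hx4 (not_lt.1 fun h' => (hx3.1 h').ne h)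
    · intro h
      exact le_antisymm hx2 (not_lt.1 fun h' => (hx3.2 h').ne h)
  have e1 : m₀.eval 1 ∈ IsLocalRing.maximalIdeal v.valuationSubring := by
    rw [IsLocalRing.mem_maximalIdeal, mem_nonunits_iff, hu, hmap, hm₀, hmh, eval_mul, map_mul, hh1]
    rw [eval_sub, eval_X, eval_C, mul_one, w.map_sub_swap]
    exact h1.ne
  have e2 : IsUnit (m₀.derivative.eval 1) := by
    rw [hu, hmap, ← derivative_map, hm₀, ← derivative_map, hmh, derivative_mul, derivative_sub,
      derivative_X, derivative_C, sub_zero, one_mul, eval_add, eval_mul, eval_sub, eval_X, eval_C]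
    rw [← hh1]
    refine w.map_add_eq_of_lt_left ?_
    rw [hh1, map_mul, w.map_sub_swap]
    refine mul_lt_one_of_lt_of_le h1 (eval_le_one w (fun i => ?_) (by simp))
    rw [coeff_derivative, map_mul]
    refine mul_le_one' (hhc _) ?_
    exact_mod_cast (natCast_mem w.integer (i + 1) : w ((i + 1 : ℕ) : L) ≤ 1)
  obtain ⟨a, ha, -⟩ := hhens.is_henselian m₀ hm₀monic 1 e1 e2
  have haroot : m.IsRoot (a : F) := by
    rw [← hm₀]
    exact ha.map (f := algebraMap v.valuationSubring F)
  exact minpoly.mem_range_of_degree_eq_one F θ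
    (degree_eq_one_of_irreducible_of_root hirr haroot)

end Henselian
end ValuedDivPaper

namespace ValuedDivPaper

open Polynomial

section Invariance

variable {L Γ' : Type*} [Field L] [LinearOrderedCommGroupWithZero Γ'] (w : Valuation L Γ')
variable {F Γ₀ : Type*} [Field F] [LinearOrderedCommGroupWithZero Γ₀] {v : Valuation F Γ₀}
  [Algebra F L]

theorem map_prod_lt_pow_card {x : L} {J : Finset L} {t : Γ'} (ht : 0 < t) (hJ : ∀ y ∈ J, w y ≤ t)
    (hx : x ∈ J) (hxt : w x < t) : w (∏ y ∈ J, y) < t ^ J.card := by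
  classical
  rw [← Finset.mul_prod_erase J _ hx, map_mul, map_prod]
  have hcard : J.card = (J.erase x).card + 1 := (Finset.card_erase_add_one hx).symm
  have h1 : ∏ y ∈ J.erase x, w y ≤ t ^ (J.erase x).card :=
    Finset.prod_le_pow_card _ _ _ fun y hy => hJ y (Finset.mem_of_mem_erase hy)
  rw [hcard, pow_succ']
  calc w x * ∏ y ∈ J.erase x, w y ≤ w x * t ^ (J.erase x).card := mul_le_mul_right h1 _
    _ < t * t ^ (J.erase x).card := by
      exact mul_lt_mul_of_pos_right hxt (pow_pos ht _)

/-- Over a Henselian field, conjugate elements of a Galois extension have equal values. -/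
theorem map_algEquiv_of_isGalois (hhens : HenselianLocalRing v.valuationSubring)
    [IsGalois F L] (hw : ∀ x : F, w (algebraMap F L x) ≤ 1 ↔ v x ≤ 1) (σ : L ≃ₐ[F] L) (y : L) :
    w (σ y) = w y := by
  classical
  rcases eq_or_ne y 0 with rfl | hy0
  · simp
  have hθint : IsIntegral F y := Algebra.IsIntegral.isIntegral y
  set S : Finset L := ((minpoly F y).aroots L).toFinset with hS
  have memS : ∀ x, x ∈ S ↔ aeval x (minpoly F y) = 0 := by
    intro x
    rw [hS, Multiset.mem_toFinset, mem_aroots]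
    simp [minpoly.ne_zero hθint]
  have hyS : y ∈ S := (memS y).2 (minpoly.aeval F y)
  have hSmap : ∀ τ : L ≃ₐ[F] L, S.map τ.toEquiv.toEmbedding = S := by
    intro τ
    refine Finset.eq_of_subset_of_card_le ?_ (by simp)
    intro x hx
    obtain ⟨z, hz, rfl⟩ := Finset.mem_map.1 hx
    rw [memS] at hz ⊢
    change aeval (τ z) _ = 0
    rw [← AlgEquiv.coe_toAlgHom τ, aeval_algHom_apply, hz, map_zero]
  obtain ⟨x0, hx0S, hx0max⟩ := Finset.exists_max_image S w ⟨y, hyS⟩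
  set t := w x0 with ht
  have ht0 : 0 < t := lt_of_lt_of_le (zero_lt_iff.2 (by simpa using hy0)) (hx0max y hyS)
  set P := S.filter fun x => w x = t with hP
  set k := P.card with hk
  set u := ∏ x ∈ P, x with hu
  set a := ∑ J ∈ S.powersetCard k, ∏ x ∈ J, x with ha
  have hPmem : P ∈ S.powersetCard k :=
    Finset.mem_powersetCard.2 ⟨Finset.filter_subset _ _, rfl⟩
  have hwu : w u = t ^ k := by
    rw [hu, map_prod, Finset.prod_congr rfl (fun x hx => (Finset.mem_filter.1 hx).2), Finset.prod_const]
  have hsmall : ∀ J ∈ S.powersetCard k, J ≠ P → w (∏ x ∈ J, x) < t ^ k := by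
    intro J hJ hne
    obtain ⟨hJS, hJk⟩ := Finset.mem_powersetCard.1 hJ
    have : ¬ J ⊆ P := fun h => hne (Finset.eq_of_subset_of_card_le h (by rw [hJk]))
    obtain ⟨x, hxJ, hxP⟩ := Finset.not_subset.1 this
    rw [← hJk]
    refine map_prod_lt_pow_card w ht0 (fun z hz => hx0max z (hJS hz)) hxJ
      (lt_of_le_of_ne (hx0max x (hJS hxJ)) fun h => hxP (Finset.mem_filter.2 ⟨hJS hxJ, h⟩))
  have htk : t ^ k ≠ 0 := pow_ne_zero _ ht0.ne'
  have hwa : w a = t ^ k := by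
    rw [← hwu, ha, hu]
    refine w.map_sum_eq_of_lt (f := fun J : Finset L => ∏ x ∈ J, x) hPmem fun J hJ => ?_
    rw [Finset.mem_sdiff, Finset.mem_singleton] at hJ
    change w (∏ x ∈ J, x) < w u
    rw [hwu]
    exact hsmall J hJ.1 hJ.2
  have hwua : w (u - a) < t ^ k := by
    have : u - a = - ∑ J ∈ S.powersetCard k \ {P}, ∏ x ∈ J, x := by
      rw [ha, Finset.sum_eq_add_sum_sdiff_singleton_of_mem hPmem]; ring
    rw [this, Valuation.map_neg]
    refine w.map_sum_lt htk fun J hJ => ?_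
    rw [Finset.mem_sdiff, Finset.mem_singleton] at hJ
    exact hsmall J hJ.1 hJ.2
  have ha0 : a ≠ 0 := by
    rintro h
    rw [h, map_zero] at hwa
    exact htk hwa.symm
  have hτa : ∀ τ : L ≃ₐ[F] L, τ a = a := by
    intro τ
    conv_rhs => rw [ha, ← hSmap τ, Finset.powersetCard_map, Finset.sum_map]
    rw [ha, map_sum]
    refine Finset.sum_congr rfl fun J _ => ?_
    rw [map_prod, RelEmbedding.coe_toEmbedding, Finset.mapEmbedding_apply, Finset.prod_map]
    rfl
  have hτu : ∀ τ : L ≃ₐ[F] L, τ u = ∏ x ∈ P.map τ.toEquiv.toEmbedding, x := by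
    intro τ
    rw [hu, map_prod, Finset.prod_map]
    rfl
  have hτmem : ∀ τ : L ≃ₐ[F] L, P.map τ.toEquiv.toEmbedding ∈ S.powersetCard k := by
    intro τ
    rw [Finset.mem_powersetCard]
    refine ⟨?_, by simp [hk]⟩
    rw [← hSmap τ]
    exact Finset.map_subset_map.2 (Finset.filter_subset _ _)
  have hdich : ∀ τ : L ≃ₐ[F] L, P.map τ.toEquiv.toEmbedding ≠ P → w (τ (u / a)) < 1 := by
    intro τ h
    rw [map_div₀, hτa, map_div₀, hwa, hτu, div_lt_one₀ (zero_lt_iff.2 htk)]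
    exact hsmall _ (hτmem τ) h
  have hθ : u / a ∈ (algebraMap F L).range := by
    refine mem_range_of_conjugates_small w hhens hw _ ?_ ?_
    · rw [div_sub_one ha0, map_div₀, hwa, div_lt_one₀ (zero_lt_iff.2 htk)]
      exact hwua
    · intro τ
      by_cases h : P.map τ.toEquiv.toEmbedding = P
      · left
        rw [map_div₀, hτa, hτu, h]
      · exact Or.inr (hdich τ h)
  have hPmap : ∀ τ : L ≃ₐ[F] L, P.map τ.toEquiv.toEmbedding = P := by
    intro τ
    by_contra h
    have h1 := hdich τ h
    obtain ⟨c, hc⟩ := hθ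
    rw [← hc, AlgEquiv.commutes, hc, map_div₀, hwu, hwa, div_self htk] at h1
    exact lt_irrefl _ h1
  have hPinv : ∀ (τ : L ≃ₐ[F] L), ∀ x ∈ P, w (τ x) = t := by
    intro τ x hx
    have : τ x ∈ P := by
      rw [← hPmap τ]
      exact Finset.mem_map.2 ⟨x, hx, rfl⟩
    exact (Finset.mem_filter.1 this).2
  have hx0P : x0 ∈ P := Finset.mem_filter.2 ⟨hx0S, rfl⟩
  obtain ⟨τ, hτ⟩ := minpoly.exists_algEquiv_of_root (Algebra.IsAlgebraic.isAlgebraic y)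
    ((memS x0).1 hx0S)
  have h1 := hPinv τ x0 hx0P
  have h2 := hPinv (τ.trans σ) x0 hx0P
  rw [AlgEquiv.trans_apply, hτ] at h2
  rw [hτ] at h1
  rw [h1, h2]

/-- Over a Henselian field, conjugate elements of a normal extension have equal values. -/
theorem map_algEquiv_of_normal (hhens : HenselianLocalRing v.valuationSubring)
    [Normal F L] (hw : ∀ x : F, w (algebraMap F L x) ≤ 1 ↔ v x ≤ 1) (σ : L ≃ₐ[F] L) (y : L) :
    w (σ y) = w y := by
  let K := separableClosure F L
  obtain ⟨n, z, hz⟩ := IsPurelyInseparable.pow_mem K (ringExpChar K) y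
  have : IsGalois F K := inferInstance
  have h := map_algEquiv_of_isGalois (w.comap (algebraMap K L)) hhens
    (fun x => by rw [Valuation.comap_apply, ← IsScalarTower.algebraMap_apply]; exact hw x)
    (σ.restrictNormal K) z
  rw [Valuation.comap_apply, Valuation.comap_apply, AlgEquiv.restrictNormal_commutes, hz, map_pow,
    map_pow, map_pow] at h
  exact (pow_left_inj₀ zero_le zero_le (pow_ne_zero _ (expChar_pos K _).ne')).1 h

theorem exists_valuation_algebraicClosure (v : Valuation F Γ₀) :
    ∃ O : ValuationSubring (AlgebraicClosure F),
      ∀ x : F, O.valuation (algebraMap F (AlgebraicClosure F) x) ≤ 1 ↔ v x ≤ 1 := by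
  let f : v.valuationSubring →+* AlgebraicClosure F :=
    (algebraMap F (AlgebraicClosure F)).comp v.valuationSubring.subtype
  obtain ⟨O, hO, hloc⟩ := IsLocalRing.exists_factor_valuationRing f
  refine ⟨O, fun x => ?_⟩
  rw [ValuationSubring.valuation_le_one_iff]
  constructor
  · intro hx
    by_contra hv
    rw [not_le] at hv
    have hx0 : x ≠ 0 := by rintro rfl; simp at hv
    have hinv : v x⁻¹ < 1 := by rw [map_inv₀]; exact inv_lt_one_of_one_lt₀ hv
    have hu : IsUnit (f.codRestrict O.toSubring hO ⟨x⁻¹, hinv.le⟩) := by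
      refine IsUnit.of_mul_eq_one ⟨_, hx⟩ ?_
      ext
      change algebraMap F _ x⁻¹ * algebraMap F _ x = 1
      rw [← map_mul, inv_mul_cancel₀ hx0, map_one]
    have hu' := hloc.map_nonunit _ hu
    have := ((Valuation.integer.integers v).isUnit_iff_valuation_eq_one (x := ⟨x⁻¹, hinv.le⟩)).1 hu'
    exact hinv.ne this
  · intro hx
    exact hO ⟨x, hx⟩

end Invariance

section MinpolyCoeff

variable {Ω Γ' : Type*} [Field Ω] [LinearOrderedCommGroupWithZero Γ'] (w : Valuation Ω Γ')
variable {F Γ₀ : Type*} [Field F] [LinearOrderedCommGroupWithZero Γ₀] {v : Valuation F Γ₀}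
  [Algebra F Ω] [Normal F Ω]

theorem minpoly_map_eq_prod (l : Ω) : (minpoly F l).map (algebraMap F Ω) =
    (((minpoly F l).aroots Ω).map fun r => X - C r).prod :=
  (Normal.splits inferInstance l).eq_prod_roots_of_monic
    ((minpoly.monic (Algebra.IsIntegral.isIntegral l)).map _)

theorem card_aroots_minpoly (l : Ω) :
    Multiset.card ((minpoly F l).aroots Ω) = (minpoly F l).natDegree := by
  rw [aroots_def, ← (Normal.splits inferInstance l).natDegree_eq_card_roots, natDegree_map]

variable (hinv : ∀ (σ : Ω ≃ₐ[F] Ω) (y : Ω), w (σ y) = w y)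
include hinv

theorem map_eq_of_mem_aroots {l r : Ω} (hr : r ∈ (minpoly F l).aroots Ω) : w r = w l := by
  obtain ⟨σ, rfl⟩ := minpoly.exists_algEquiv_of_root' (Algebra.IsAlgebraic.isAlgebraic l)
    (mem_aroots.1 hr).2
  exact hinv σ l

variable (hw : ∀ x : F, w (algebraMap F Ω x) ≤ 1 ↔ v x ≤ 1)

theorem map_coeff_zero_minpoly (l : Ω) :
    w (algebraMap F Ω ((minpoly F l).coeff 0)) = w l ^ (minpoly F l).natDegree := by
  have hc := card_aroots_minpoly (F := F) l
  rw [← coeff_map, minpoly_map_eq_prod, coeff_zero_multiset_prod, map_multiset_prod,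
    Multiset.map_map, Multiset.map_map,
    Multiset.map_congr rfl (g := fun _ => w l), Multiset.map_const', Multiset.prod_replicate, hc]
  intro r hr
  simp [map_eq_of_mem_aroots w hinv hr]

include hw

theorem coeff_minpoly_le_one {l : Ω} (hl : w l ≤ 1) (i : ℕ) : v ((minpoly F l).coeff i) ≤ 1 := by
  rw [← hw, ← coeff_map, minpoly_map_eq_prod]
  exact coeff_prod_X_sub_C_le_one w _ (fun r hr => by rwa [map_eq_of_mem_aroots w hinv hr]) i

theorem coeff_minpoly_lt_one {l : Ω} (hl : w l < 1) (i : ℕ) (hi : i < (minpoly F l).natDegree) :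
    v ((minpoly F l).coeff i) < 1 := by
  rw [← map_lt_one_iff_of_le_one_iff w hw, ← coeff_map, minpoly_map_eq_prod]
  exact coeff_prod_X_sub_C_lt_one w _ (fun r hr => by rwa [map_eq_of_mem_aroots w hinv hr]) i
    (by rwa [card_aroots_minpoly])

theorem coeff_zero_minpoly_eq_one {l : Ω} (hl : w l = 1) : v ((minpoly F l).coeff 0) = 1 := by
  have h1 := map_coeff_zero_minpoly w hinv l
  rw [hl, one_pow] at h1
  have h2 := map_lt_one_iff_of_le_one_iff w hw ((minpoly F l).coeff 0)
  have h3 := (hw ((minpoly F l).coeff 0)).1 h1.le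
  exact le_antisymm h3 (not_lt.1 fun h => (h2.2 h).ne h1)

end MinpolyCoeff

end ValuedDivPaper

namespace ValuedDivPaper

open Polynomial

section Uniqueness

variable {F Γ₀ : Type*} [Field F] [LinearOrderedCommGroupWithZero Γ₀] {v : Valuation F Γ₀}
  {E : Type*} [DivisionRing E] [Algebra F E] (W : Valuation E Γ₀)
  (hW : ∀ x : F, W (algebraMap F E x) = v x)

include hW

theorem map_smul_of_extends (c : F) (x : E) : W (c • x) = v c * W x := by
  rw [Algebra.smul_def, map_mul, hW]

theorem map_le_one_of_aeval_eq_zero {q : F[X]} (hq : q.Monic) (hc : ∀ i, v (q.coeff i) ≤ 1)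
    {η : E} (h : aeval η q = 0) : W η ≤ 1 := by
  by_contra hη
  rw [not_le] at hη
  rw [aeval_eq_sum_range, Finset.sum_range_succ, coeff_natDegree, hq, one_smul,
    add_eq_zero_iff_neg_eq] at h
  have h0 : W η ≠ 0 := (zero_lt_one.trans hη).ne'
  have : W (∑ i ∈ Finset.range q.natDegree, q.coeff i • η ^ i) < W (η ^ q.natDegree) := by
    refine W.map_sum_lt (by rw [map_pow]; exact pow_ne_zero _ h0) fun i hi => ?_
    rw [map_smul_of_extends W hW, map_pow, map_pow]
    calc v (q.coeff i) * W η ^ i ≤ 1 * W η ^ i := mul_le_mul_left (hc i) _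
      _ = W η ^ i := one_mul _
      _ < W η ^ q.natDegree := pow_lt_pow_right₀ hη (Finset.mem_range.1 hi)
  rw [← h, Valuation.map_neg] at this
  exact lt_irrefl _ this

theorem map_aeval_le_one {q : F[X]} (hc : ∀ i, v (q.coeff i) ≤ 1) {η : E} (h : W η ≤ 1) :
    W (aeval η q) ≤ 1 := by
  rw [aeval_eq_sum_range]
  refine W.map_sum_le fun i _ => ?_
  rw [map_smul_of_extends W hW, map_pow]
  exact mul_le_one' (hc i) (pow_le_one' h i)

theorem map_eq_one_of_aeval_eq_zero {q : F[X]} (hq : q.Monic) (hc : ∀ i, v (q.coeff i) ≤ 1)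
    (h0 : v (q.coeff 0) = 1) {η : E} (h : aeval η q = 0) : W η = 1 := by
  have hle := map_le_one_of_aeval_eq_zero W hW hq hc h
  refine le_antisymm hle ?_
  rw [← X_mul_divX_add q, map_add, map_mul, aeval_X, aeval_C, add_eq_zero_iff_neg_eq] at h
  have h1 : W (η * aeval η q.divX) = 1 := by
    rw [← Valuation.map_neg, h, hW, h0]
  rw [map_mul] at h1
  rw [← h1]
  refine mul_le_of_le_one_right' ?_
  exact map_aeval_le_one W hW (fun i => by rw [coeff_divX]; exact hc _) hle

/-- The unique extension of a Henselian valuation to a division algebra is given by the constant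
term of the minimal polynomial. -/
theorem map_pow_natDegree_minpoly [FiniteDimensional F E]
    (hhens : HenselianLocalRing v.valuationSubring) (y : E) :
    W y ^ (minpoly F y).natDegree = v ((minpoly F y).coeff 0) := by
  have hθint : IsIntegral F y := Algebra.IsIntegral.isIntegral y
  have hirr : Irreducible (minpoly F y) := minpoly.irreducible hθint
  have hpos : 0 < (minpoly F y).natDegree := minpoly.natDegree_pos hθint
  rcases eq_or_ne y 0 with rfl | hy0
  · rw [map_zero, zero_pow hpos.ne', minpoly.zero, coeff_X_zero, map_zero]
  obtain ⟨O, hO⟩ := exists_valuation_algebraicClosure v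
  let Ω := AlgebraicClosure F
  set w := O.valuation with hwdef
  have hinv : ∀ (σ : Ω ≃ₐ[F] Ω) (z : Ω), w (σ z) = w z := map_algEquiv_of_normal w hhens hO
  obtain ⟨l, hl⟩ := IsAlgClosed.exists_aeval_eq_zero Ω (minpoly F y) (degree_pos_of_irreducible hirr).ne'
  have hp : minpoly F y = minpoly F l :=
    minpoly.eq_of_irreducible_of_monic hirr hl (minpoly.monic hθint)
  set p := minpoly F y with hpdef
  set a := p.coeff 0 with ha
  set m := p.natDegree with hm
  have ha0 : a ≠ 0 := minpoly.coeff_zero_ne_zero hθint hy0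
  have hwl : w (algebraMap F Ω a) = w l ^ m := by
    rw [ha, hm, hp]; exact map_coeff_zero_minpoly w hinv l
  have hwa0 : w (algebraMap F Ω a) ≠ 0 := by simpa using ha0
  have hl0 : w (aeval l (C a⁻¹ * X ^ m : F[X])) = 1 := by
    rw [map_mul, aeval_C, map_pow, aeval_X, map_mul, map_pow, ← hwl, map_inv₀, map_inv₀,
      inv_mul_cancel₀ hwa0]
  set l0 := aeval l (C a⁻¹ * X ^ m : F[X]) with hl0def
  have hcomp : aeval y ((minpoly F l0).comp (C a⁻¹ * X ^ m)) = 0 := by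
    have : p ∣ (minpoly F l0).comp (C a⁻¹ * X ^ m) := by
      rw [hp]
      refine minpoly.dvd F l ?_
      rw [aeval_comp, ← hl0def, minpoly.aeval]
    obtain ⟨r, hr⟩ := this
    rw [hr, map_mul, minpoly.aeval, zero_mul]
  rw [aeval_comp] at hcomp
  have h1 := map_eq_one_of_aeval_eq_zero W hW
    (minpoly.monic (Algebra.IsIntegral.isIntegral l0))
    (coeff_minpoly_le_one w hinv hO hl0.le) (coeff_zero_minpoly_eq_one w hinv hO hl0) hcomp
  rw [map_mul, aeval_C, map_pow, aeval_X, map_mul, map_pow, hW, map_inv₀] at h1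
  exact (inv_mul_eq_one₀ (by simpa using ha0)).1 h1 |>.symm

theorem valuation_eq_of_extends [FiniteDimensional F E]
    (hhens : HenselianLocalRing v.valuationSubring) (W' : Valuation E Γ₀)
    (hW' : ∀ x : F, W' (algebraMap F E x) = v x) : W = W' := by
  ext y
  refine (pow_left_inj₀ zero_le zero_le
    (minpoly.natDegree_pos (Algebra.IsIntegral.isIntegral (R := F) y)).ne').1 ?_
  rw [map_pow_natDegree_minpoly W hW hhens, map_pow_natDegree_minpoly W' hW' hhens]

end Uniqueness

end ValuedDivPaper

namespace ValuedDivPaper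

open Polynomial

/-- A submultiplicative value function on an algebra over a valued field, together with a
surjective residue map from its unit ball; `ρ` is only meaningful where `α ≤ 1`. -/
structure Gauge {F Γ₀ : Type*} [Field F] [LinearOrderedCommGroupWithZero Γ₀]
    (v : Valuation F Γ₀) (A R : Type*) [Ring A] [Algebra F A] [Ring R] where
  /-- the value function -/
  α : A → Γ₀
  /-- the residue map -/
  ρ : A → R
  α_eq_zero : ∀ {x}, α x = 0 ↔ x = 0
  α_add : ∀ x y, α (x + y) ≤ max (α x) (α y)
  α_mul : ∀ x y, α (x * y) ≤ α x * α y
  α_one : α 1 = 1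
  α_smul : ∀ (c : F) x, α (c • x) = v c * α x
  ρ_add : ∀ {x y}, α x ≤ 1 → α y ≤ 1 → ρ (x + y) = ρ x + ρ y
  ρ_mul : ∀ {x y}, α x ≤ 1 → α y ≤ 1 → ρ (x * y) = ρ x * ρ y
  ρ_one : ρ 1 = 1
  ρ_eq_zero : ∀ {x}, α x ≤ 1 → (ρ x = 0 ↔ α x < 1)
  ρ_surj : ∀ r, ∃ x, α x ≤ 1 ∧ ρ x = r

namespace Gauge

variable {F Γ₀ : Type*} [Field F] [LinearOrderedCommGroupWithZero Γ₀]
    {v : Valuation F Γ₀} {A R : Type*} [Ring A] [Algebra F A] [Ring R] (G : Gauge v A R)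

include G

theorem α_zero : G.α 0 = 0 := G.α_eq_zero.2 rfl

theorem α_neg (x : A) : G.α (-x) = G.α x := by
  rw [← neg_one_smul F x, G.α_smul, Valuation.map_neg, map_one, one_mul]

theorem α_sub (x y : A) : G.α (x - y) ≤ max (G.α x) (G.α y) := by
  rw [sub_eq_add_neg, ← G.α_neg y]
  exact G.α_add _ _

theorem α_add_le {x y : A} {t : Γ₀} (hx : G.α x ≤ t) (hy : G.α y ≤ t) : G.α (x + y) ≤ t :=
  (G.α_add x y).trans (max_le hx hy)

theorem α_sub_le {x y : A} {t : Γ₀} (hx : G.α x ≤ t) (hy : G.α y ≤ t) : G.α (x - y) ≤ t :=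
  (G.α_sub x y).trans (max_le hx hy)

theorem α_mul_le_one {x y : A} (hx : G.α x ≤ 1) (hy : G.α y ≤ 1) : G.α (x * y) ≤ 1 :=
  (G.α_mul x y).trans (mul_le_one' hx hy)

theorem α_pow_le_one {x : A} (hx : G.α x ≤ 1) (i : ℕ) : G.α (x ^ i) ≤ 1 := by
  induction i with
  | zero => rw [pow_zero, G.α_one]
  | succ i ih => rw [pow_succ]; exact G.α_mul_le_one ih hx

theorem α_smul_le_one {c : F} {x : A} (hc : v c ≤ 1) (hx : G.α x ≤ 1) : G.α (c • x) ≤ 1 := by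
  rw [G.α_smul]; exact mul_le_one' hc hx

theorem α_sum_le {ι : Type*} (s : Finset ι) {f : ι → A} {t : Γ₀} (h : ∀ i ∈ s, G.α (f i) ≤ t) :
    G.α (∑ i ∈ s, f i) ≤ t := by
  classical
  induction s using Finset.induction_on with
  | empty => simp [G.α_zero]
  | insert a s ha ih =>
    rw [Finset.sum_insert ha]
    exact G.α_add_le (h a (Finset.mem_insert_self a s))
      (ih fun i hi => h i (Finset.mem_insert_of_mem hi))

theorem α_sum_lt_one {ι : Type*} (s : Finset ι) {f : ι → A} (h : ∀ i ∈ s, G.α (f i) < 1) :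
    G.α (∑ i ∈ s, f i) < 1 := by
  classical
  induction s using Finset.induction_on with
  | empty => simp [G.α_zero]
  | insert a s ha ih =>
    rw [Finset.sum_insert ha]
    exact (G.α_add _ _).trans_lt (max_lt (h a (Finset.mem_insert_self a s))
      (ih fun i hi => h i (Finset.mem_insert_of_mem hi)))

theorem ρ_of_lt {x : A} (hx : G.α x < 1) : G.ρ x = 0 := (G.ρ_eq_zero hx.le).2 hx

theorem ρ_zero : G.ρ 0 = 0 := G.ρ_of_lt (by rw [G.α_zero]; exact zero_lt_one)

theorem ρ_neg {x : A} (hx : G.α x ≤ 1) : G.ρ (-x) = - G.ρ x := by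
  rw [eq_neg_iff_add_eq_zero, ← G.ρ_add (by rwa [G.α_neg]) hx, neg_add_cancel, G.ρ_zero]

theorem ρ_sub {x y : A} (hx : G.α x ≤ 1) (hy : G.α y ≤ 1) : G.ρ (x - y) = G.ρ x - G.ρ y := by
  rw [sub_eq_add_neg, G.ρ_add hx (by rwa [G.α_neg]), G.ρ_neg hy, sub_eq_add_neg]

theorem ρ_pow {x : A} (hx : G.α x ≤ 1) (i : ℕ) : G.ρ (x ^ i) = G.ρ x ^ i := by
  induction i with
  | zero => rw [pow_zero, pow_zero, G.ρ_one]
  | succ i ih => rw [pow_succ, pow_succ, G.ρ_mul (G.α_pow_le_one hx i) hx, ih]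

theorem ρ_sum {ι : Type*} (s : Finset ι) {f : ι → A} (h : ∀ i ∈ s, G.α (f i) ≤ 1) :
    G.ρ (∑ i ∈ s, f i) = ∑ i ∈ s, G.ρ (f i) := by
  classical
  induction s using Finset.induction_on with
  | empty => simp [G.ρ_zero]
  | insert a s ha ih =>
    rw [Finset.sum_insert ha, Finset.sum_insert ha,
      G.ρ_add (h a (Finset.mem_insert_self a s))
        (G.α_sum_le s fun i hi => h i (Finset.mem_insert_of_mem hi)),
      ih fun i hi => h i (Finset.mem_insert_of_mem hi)]

theorem α_eq_one_of_ρ_ne_zero {x : A} (hx : G.α x ≤ 1) (h : G.ρ x ≠ 0) : G.α x = 1 :=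
  hx.eq_of_not_lt fun h' => h (G.ρ_of_lt h')

theorem ρ_ne_zero {x : A} (hx : G.α x = 1) : G.ρ x ≠ 0 := fun h =>
  ((G.ρ_eq_zero hx.le).1 h).ne hx

theorem α_one_sub_lt {x : A} (hx : G.α x ≤ 1) (h : G.ρ x = 1) : G.α (1 - x) < 1 := by
  rw [← G.ρ_eq_zero (G.α_sub_le G.α_one.le hx), G.ρ_sub G.α_one.le hx, G.ρ_one, h, sub_self]

theorem mul_left_injective_of_lt {x : A} (hx : G.α (1 - x) < 1) {y : A} (h : x * y = 0) :
    y = 0 := by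
  by_contra hy
  have h0 : 0 < G.α y := zero_lt_iff.2 fun h => hy (G.α_eq_zero.1 h)
  have h1 : y = (1 - x) * y := by rw [sub_mul, one_mul, h, sub_zero]
  have h2 : G.α y ≤ G.α (1 - x) * G.α y := by
    conv_lhs => rw [h1]
    exact G.α_mul _ _
  have h3 : G.α (1 - x) * G.α y < 1 * G.α y := mul_lt_mul_of_pos_right hx h0
  rw [one_mul] at h3
  exact (h2.trans_lt h3).false

/-- Elements with residue `1` are units with residue `1`. -/
theorem exists_inverse [FiniteDimensional F A] {x : A} (hx : G.α x ≤ 1) (h : G.ρ x = 1) :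
    ∃ y, x * y = 1 ∧ y * x = 1 ∧ G.α y ≤ 1 ∧ G.ρ y = 1 := by
  have hlt := G.α_one_sub_lt hx h
  have hinj : Function.Injective (LinearMap.mulLeft F x) := by
    rw [← LinearMap.ker_eq_bot, LinearMap.ker_eq_bot']
    intro y hy
    exact G.mul_left_injective_of_lt hlt hy
  obtain ⟨y, hy⟩ := LinearMap.injective_iff_surjective.1 hinj 1
  have hxy : x * y = 1 := hy
  have hyx : y * x = 1 := by
    refine hinj ?_
    change x * (y * x) = x * 1
    rw [← mul_assoc, hxy, one_mul, mul_one]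
  have e1 : y = 1 + (1 - x) * y := by rw [sub_mul, one_mul, hxy]; abel
  have hy1 : G.α y ≤ 1 := by
    by_contra hc
    rw [not_le] at hc
    have h0 : 0 < G.α y := zero_lt_one.trans hc
    have h3 : G.α (1 - x) * G.α y < 1 * G.α y := mul_lt_mul_of_pos_right hlt h0
    rw [one_mul] at h3
    have h4 : G.α y ≤ max (G.α 1) (G.α ((1 - x) * y)) := by
      conv_lhs => rw [e1]
      exact G.α_add _ _
    rcases le_max_iff.1 h4 with h5 | h5
    · rw [G.α_one] at h5; exact hc.not_ge h5
    · exact ((h5.trans (G.α_mul _ _)).trans_lt h3).false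
  refine ⟨y, hxy, hyx, hy1, ?_⟩
  have := G.ρ_mul hx hy1
  rw [hxy, G.ρ_one, h, one_mul] at this
  exact this.symm

theorem ρ_aeval_of_coeff_lt {q : F[X]} (hq : q.Monic)
    (hc : ∀ i < q.natDegree, v (q.coeff i) < 1) {x : A} (hx : G.α x ≤ 1) :
    G.α (aeval x q) ≤ 1 ∧ G.ρ (aeval x q) = G.ρ x ^ q.natDegree := by
  rw [aeval_eq_sum_range, Finset.sum_range_succ, coeff_natDegree, hq, one_smul]
  have h1 : G.α (∑ i ∈ Finset.range q.natDegree, q.coeff i • x ^ i) < 1 := by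
    refine G.α_sum_lt_one _ fun i hi => ?_
    rw [G.α_smul]
    exact mul_lt_one_of_lt_of_le (hc i (Finset.mem_range.1 hi)) (G.α_pow_le_one hx i)
  have h2 := G.α_pow_le_one hx q.natDegree
  exact ⟨G.α_add_le h1.le h2, by rw [G.ρ_add h1.le h2, G.ρ_of_lt h1, zero_add, G.ρ_pow hx]⟩

theorem α_one_sub_aeval_lt {q : F[X]} (hc : ∀ i, v (q.coeff i) ≤ 1) (h0 : q.coeff 0 = 1)
    {x : A} (hx : G.α x < 1) : G.α (1 - aeval x q) < 1 := by
  rw [← X_mul_divX_add q, h0, map_add, map_mul, aeval_X, map_one, map_one, sub_add_cancel_right,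
    G.α_neg]
  refine (G.α_mul _ _).trans_lt (mul_lt_one_of_lt_of_le hx ?_)
  rw [aeval_eq_sum_range]
  exact G.α_sum_le _ fun i _ =>
    G.α_smul_le_one (by rw [coeff_divX]; exact hc _) (G.α_pow_le_one hx.le i)

theorem exists_poly_of_irreducible [FiniteDimensional F A]
    (hhens : HenselianLocalRing v.valuationSubring) {x : A} (hx : G.α x ≤ 1)
    (hid : G.ρ x * G.ρ x = G.ρ x) {p : F[X]} (hp : Irreducible p) (hdvd : p ∣ minpoly F x) :
    ∃ q, p ∣ q ∧ G.α (aeval x q) ≤ 1 ∧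
      (G.ρ (aeval x q) = G.ρ x ∨ G.ρ (aeval x q) = 1 - G.ρ x) := by
  obtain ⟨O, hO⟩ := exists_valuation_algebraicClosure v
  let Ω := AlgebraicClosure F
  set w := O.valuation with hwdef
  have hinv : ∀ (σ : Ω ≃ₐ[F] Ω) (z : Ω), w (σ z) = w z := map_algEquiv_of_normal w hhens hO
  obtain ⟨l, hl⟩ := IsAlgClosed.exists_aeval_eq_zero Ω p (degree_pos_of_irreducible hp).ne'
  have hpdvd : ∀ q : F[X], aeval l q = 0 → p ∣ q := by
    intro q hq
    have h1 := minpoly.dvd F l hq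
    have h2 := minpoly.dvd F l hl
    have h3 : Associated (minpoly F l) p :=
      (minpoly.irreducible (Algebra.IsIntegral.isIntegral l)).associated_of_dvd hp h2
    exact h3.symm.dvd.trans h1
  have hpow : ∀ {r : R} (_ : r * r = r) {m : ℕ}, 0 < m → r ^ m = r := by
    intro r hr m hm
    exact IsIdempotentElem.pow_eq (show IsIdempotentElem r from hr) hm.ne'
  have hxid : G.α (x * x - x) < 1 := by
    rw [← G.ρ_eq_zero (G.α_sub_le (G.α_mul_le_one hx hx) hx),
      G.ρ_sub (G.α_mul_le_one hx hx) hx, G.ρ_mul hx hx, hid, sub_self]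
  have key : w (l * l - l) < 1 := by
    by_contra hc
    rw [not_lt] at hc
    set μ := l * l - l with hμ
    have hμ0 : μ ≠ 0 := by
      intro h; rw [h, map_zero] at hc; exact (zero_lt_one.trans_le hc).false
    have hν : w μ⁻¹ ≤ 1 := by rw [map_inv₀]; exact inv_le_one_of_one_le₀ hc
    have hcoef := coeff_minpoly_le_one w hinv hO hν
    set h := minpoly F μ⁻¹ with hh
    have hmon : h.Monic := minpoly.monic (Algebra.IsIntegral.isIntegral _)
    have hrev : aeval μ h.reverse = 0 := by
      rw [aeval_def, ← inv_inv μ]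
      let _ : Invertible μ⁻¹ := invertibleOfNonzero (inv_ne_zero hμ0)
      have := (eval₂_reverse_eq_zero_iff (algebraMap F Ω) μ⁻¹ h).2 (by
        rw [← aeval_def, hh, minpoly.aeval])
      rwa [invOf_eq_inv] at this
    have hdv : p ∣ h.reverse.comp (X * X - X) := by
      refine hpdvd _ ?_
      rw [aeval_comp, map_sub, map_mul, aeval_X, ← hμ, hrev]
    have hlt := G.α_one_sub_aeval_lt (q := h.reverse) (x := x * x - x)
      (fun i => by rw [coeff_reverse]; exact hcoef _)
      (by rw [coeff_zero_reverse]; exact hmon) hxid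
    obtain ⟨s, hs⟩ := hdv
    obtain ⟨g', hg'⟩ := hdvd
    have hs' : aeval (x * x - x) h.reverse = aeval x s * aeval x p := by
      rw [← map_mul, mul_comm, ← hs, aeval_comp, map_sub, map_mul, aeval_X]
    have hg0 : aeval x g' = 0 := by
      refine G.mul_left_injective_of_lt hlt ?_
      rw [hs', mul_assoc, ← map_mul, ← hg', minpoly.aeval, mul_zero]
    have hne : minpoly F x ≠ 0 := minpoly.ne_zero (Algebra.IsIntegral.isIntegral x)
    have hg'0 : g' ≠ 0 := by rintro rfl; rw [mul_zero] at hg'; exact hne hg'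
    have hd := natDegree_le_of_dvd (minpoly.dvd F x hg0) hg'0
    rw [hg', natDegree_mul hp.ne_zero hg'0] at hd
    have := hp.natDegree_pos
    omega
  have hcase : w l < 1 ∨ w (1 - l) < 1 := by
    by_contra hc
    push Not at hc
    have : 1 ≤ w (l * (1 - l)) := by rw [map_mul]; exact one_le_mul hc.1 hc.2
    rw [show l * (1 - l) = -(l * l - l) by ring, Valuation.map_neg] at this
    exact key.not_ge this
  rcases hcase with hc | hc
  · have hmon : (minpoly F l).Monic := minpoly.monic (Algebra.IsIntegral.isIntegral _)
    obtain ⟨h1, h2⟩ := G.ρ_aeval_of_coeff_lt hmon (coeff_minpoly_lt_one w hinv hO hc) hx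
    refine ⟨minpoly F l, hpdvd _ (minpoly.aeval F l), h1, Or.inl ?_⟩
    rw [h2, hpow hid (minpoly.natDegree_pos (Algebra.IsIntegral.isIntegral _))]
  · have hmon : (minpoly F (1 - l)).Monic := minpoly.monic (Algebra.IsIntegral.isIntegral _)
    have hx' : G.α (1 - x) ≤ 1 := G.α_sub_le G.α_one.le hx
    have hρ' : G.ρ (1 - x) = 1 - G.ρ x := by rw [G.ρ_sub G.α_one.le hx, G.ρ_one]
    obtain ⟨h1, h2⟩ := G.ρ_aeval_of_coeff_lt hmon (coeff_minpoly_lt_one w hinv hO hc) hx'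
    refine ⟨(minpoly F (1 - l)).comp (1 - X), hpdvd _ ?_, ?_, Or.inr ?_⟩
    · rw [aeval_comp, map_sub, map_one, aeval_X, minpoly.aeval]
    · rwa [aeval_comp, map_sub, map_one, aeval_X]
    · rw [aeval_comp, map_sub, map_one, aeval_X, h2, hρ']
      refine hpow ?_ (minpoly.natDegree_pos (Algebra.IsIntegral.isIntegral _))
      exact IsIdempotentElem.one_sub (show IsIdempotentElem (G.ρ x) from hid)

/-- Idempotents of the residue ring lift. -/
theorem exists_idempotent_lift [FiniteDimensional F A]
    (hhens : HenselianLocalRing v.valuationSubring) (r : R) (hr : r * r = r) :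
    ∃ e : A, e * e = e ∧ G.α e ≤ 1 ∧ G.ρ e = r := by
  obtain ⟨x, hx, rfl⟩ := G.ρ_surj r
  have hid' : (1 - G.ρ x) * (1 - G.ρ x) = 1 - G.ρ x :=
    IsIdempotentElem.one_sub (show IsIdempotentElem (G.ρ x) from hr)
  have main : ∀ g : F[X], g ∣ minpoly F x → ∃ g0 g1 : F[X], g ∣ g0 * g1 ∧ G.α (aeval x g0) ≤ 1 ∧
      G.α (aeval x g1) ≤ 1 ∧ G.ρ (aeval x g0) = G.ρ x ∧ G.ρ (aeval x g1) = 1 - G.ρ x := by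
    intro g
    induction g using WfDvdMonoid.induction_on_irreducible with
    | zero =>
      intro h
      exact absurd (zero_dvd_iff.1 h) (minpoly.ne_zero (Algebra.IsIntegral.isIntegral x))
    | unit u hu =>
      intro _
      refine ⟨X, 1 - X, hu.dvd, ?_, ?_, ?_, ?_⟩
      · rwa [aeval_X]
      · rw [map_sub, map_one, aeval_X]; exact G.α_sub_le G.α_one.le hx
      · rw [aeval_X]
      · rw [map_sub, map_one, aeval_X, G.ρ_sub G.α_one.le hx, G.ρ_one]
    | mul a i ha hi ih =>
      intro h
      obtain ⟨g0, g1, hg, h0, h1, h0', h1'⟩ := ih (dvd_of_mul_left_dvd h)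
      obtain ⟨q, hq, hq1, hq2⟩ := G.exists_poly_of_irreducible hhens hx hr hi
        (dvd_of_mul_right_dvd h)
      rcases hq2 with hq2 | hq2
      · refine ⟨q * g0, g1, ?_, ?_, h1, ?_, h1'⟩
        · rw [mul_assoc]; exact mul_dvd_mul hq hg
        · rw [map_mul]; exact G.α_mul_le_one hq1 h0
        · rw [map_mul, G.ρ_mul hq1 h0, hq2, h0', hr]
      · refine ⟨g0, q * g1, ?_, h0, ?_, h0', ?_⟩
        · rw [mul_left_comm]; exact mul_dvd_mul hq hg
        · rw [map_mul]; exact G.α_mul_le_one hq1 h1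
        · rw [map_mul, G.ρ_mul hq1 h1, hq2, h1', hid']
  obtain ⟨g0, g1, hg, h0, h1, h0', h1'⟩ := main _ dvd_rfl
  set a := aeval x g0 with ha
  set b := aeval x g1 with hb
  have hab : a * b = 0 := by
    obtain ⟨s, hs⟩ := hg
    rw [ha, hb, ← map_mul, hs, map_mul, minpoly.aeval, zero_mul]
  have hba : b * a = 0 := by
    rw [ha, hb, ← map_mul, mul_comm, map_mul]; exact hab
  obtain ⟨y, hy1, hy2, hy3, hy4⟩ := G.exists_inverse (G.α_add_le h0 h1)
    (by rw [G.ρ_add h0 h1, h0', h1', add_sub_cancel])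
  have hcomm : y * a = a * y := by
    calc y * a = y * (a * ((a + b) * y)) := by rw [hy1, mul_one]
      _ = y * (((a + b) * a) * y) := by
        rw [← mul_assoc a, show a * (a + b) = (a + b) * a by rw [mul_add, add_mul, hab, hba]]
      _ = (y * (a + b)) * (a * y) := by simp only [mul_assoc]
      _ = a * y := by rw [hy2, one_mul]
  refine ⟨a * y, ?_, G.α_mul_le_one h0 hy3, by rw [G.ρ_mul h0 hy3, hy4, mul_one, h0']⟩
  calc a * y * (a * y) = a * (y * a) * y := by simp only [mul_assoc]
    _ = a * (a + b) * y * y := by rw [hcomm, mul_add, hab, add_zero, mul_assoc a a y]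
    _ = a * ((a + b) * y) * y := by simp only [mul_assoc]
    _ = a * y := by rw [hy1, mul_one]

end Gauge

end ValuedDivPaper

namespace ValuedDivPaper

section TotalResidue

variable {Γ₀ : Type*} [LinearOrderedCommGroupWithZero Γ₀]

namespace ResidueData

variable {R : Type*} [Ring R] {w : Valuation R Γ₀} {Rbar : Type*} [Ring Rbar]
  (r : ResidueData w Rbar)

open Classical in
/-- The residue map extended by zero outside the valuation ring. -/
def res (x : R) : Rbar := if h : x ∈ w.integer then r.π ⟨x, h⟩ else 0

theorem res_of_mem {x : R} (h : x ∈ w.integer) : r.res x = r.π ⟨x, h⟩ := dif_pos h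

theorem res_add {x y : R} (hx : w x ≤ 1) (hy : w y ≤ 1) : r.res (x + y) = r.res x + r.res y := by
  rw [r.res_of_mem (x := x) hx, r.res_of_mem (x := y) hy, ← map_add]
  exact r.res_of_mem _

theorem res_mul {x y : R} (hx : w x ≤ 1) (hy : w y ≤ 1) : r.res (x * y) = r.res x * r.res y := by
  rw [r.res_of_mem (x := x) hx, r.res_of_mem (x := y) hy, ← map_mul]
  exact r.res_of_mem _

theorem res_one : r.res 1 = 1 := by
  rw [r.res_of_mem (one_mem _)]
  exact map_one r.π

theorem res_eq_zero {x : R} (hx : w x ≤ 1) : r.res x = 0 ↔ w x < 1 := by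
  rw [r.res_of_mem hx]
  exact r.ker ⟨x, hx⟩

theorem res_zero : r.res 0 = 0 := (r.res_eq_zero (by simp)).2 (by simp)

theorem exists_res_eq (a : Rbar) : ∃ x, w x ≤ 1 ∧ r.res x = a := by
  obtain ⟨x, rfl⟩ := r.surj a
  exact ⟨x, x.2, r.res_of_mem x.2⟩

theorem res_sum {ι : Type*} (s : Finset ι) {f : ι → R} (h : ∀ i ∈ s, w (f i) ≤ 1) :
    r.res (∑ i ∈ s, f i) = ∑ i ∈ s, r.res (f i) := by
  classical
  induction s using Finset.induction_on with
  | empty => simp [r.res_zero]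
  | insert a s ha ih =>
    rw [Finset.sum_insert ha, Finset.sum_insert ha,
      r.res_add (h a (Finset.mem_insert_self a s))
        (w.map_sum_le fun i hi => h i (Finset.mem_insert_of_mem hi)),
      ih fun i hi => h i (Finset.mem_insert_of_mem hi)]

end ResidueData

variable {F : Type*} [Field F] {v : Valuation F Γ₀} {Fbar : Type*} [Field Fbar]
  {rF : ResidueData v Fbar} {D : Type*} [DivisionRing D] [Algebra F D] {wD : Valuation D Γ₀}
  {Dbar : Type*} [DivisionRing Dbar] [Algebra Fbar Dbar] {rD : ResidueData wD Dbar}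

theorem ResCompat.res_algebraMap (hc : ResCompat v wD rF rD)
    (hw : ∀ x : F, wD (algebraMap F D x) = v x) {x : F} (hx : v x ≤ 1) :
    rD.res (algebraMap F D x) = algebraMap Fbar Dbar (rF.res x) := by
  have h : algebraMap F D x ∈ wD.integer := by
    change wD _ ≤ 1
    rwa [hw]
  rw [rD.res_of_mem h, rF.res_of_mem (x := x) hx, hc x hx h]

theorem ResCompat.res_smul (hc : ResCompat v wD rF rD)
    (hw : ∀ x : F, wD (algebraMap F D x) = v x) {x : F} (hx : v x ≤ 1) {d : D} (hd : wD d ≤ 1) :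
    rD.res (x • d) = rF.res x • rD.res d := by
  rw [Algebra.smul_def, rD.res_mul (by rwa [hw]) hd, hc.res_algebraMap hw hx, Algebra.smul_def]

end TotalResidue

section ResidueBasis

variable {Γ₀ : Type*} [LinearOrderedCommGroupWithZero Γ₀]
  {F : Type*} [Field F] {v : Valuation F Γ₀} {Fbar : Type*} [Field Fbar]
  {rF : ResidueData v Fbar} {I : Type*} [DivisionRing I] [Algebra F I] {wI : Valuation I Γ₀}
  {Ibar : Type*} [DivisionRing Ibar] [Algebra Fbar Ibar] {rI : ResidueData wI Ibar}
  (hc : ResCompat v wI rF rI) (hw : ∀ x : F, wI (algebraMap F I x) = v x)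
  {ι : Type*} [Fintype ι]

include hc hw

/-- Lifts of linearly independent residues are orthogonal. -/
theorem map_sum_smul_of_residue_linearIndependent {a : ι → I} (ha : ∀ i, wI (a i) ≤ 1)
    (hli : LinearIndependent Fbar fun i => rI.res (a i)) (c : ι → F) :
    wI (∑ i, c i • a i) = Finset.univ.sup fun i => v (c i) := by
  rcases isEmpty_or_nonempty ι with hι | hι
  · simp [bot_eq_zero]
  obtain ⟨j, -, hj⟩ := Finset.exists_mem_eq_sup (Finset.univ : Finset ι)
    Finset.univ_nonempty fun i => v (c i)
  rw [hj]
  have hle : ∀ i, v (c i) ≤ v (c j) := fun i => by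
    rw [← hj]; exact Finset.le_sup (f := fun i => v (c i)) (Finset.mem_univ i)
  by_cases h0 : c j = 0
  · have : ∀ i, c i = 0 := fun i => by
      have := hle i
      rw [h0, map_zero] at this
      simpa using this
    simp [this]
  have hv0 : v (c j) ≠ 0 := by simpa using h0
  set d : ι → F := fun i => (c j)⁻¹ * c i with hd
  have hd1 : ∀ i, v (d i) ≤ 1 := fun i => by
    rw [hd, map_mul, map_inv₀]
    exact inv_mul_le_one_of_le₀ (hle i) zero_le
  have hsum : ∑ i, c i • a i = c j • ∑ i, d i • a i := by
    rw [Finset.smul_sum]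
    refine Finset.sum_congr rfl fun i _ => ?_
    rw [smul_smul, hd, mul_inv_cancel_left₀ h0]
  have hterm : ∀ i ∈ Finset.univ, wI (d i • a i) ≤ 1 := fun i _ => by
    rw [map_smul_of_extends wI hw]; exact mul_le_one' (hd1 i) (ha i)
  have hres : rI.res (∑ i, d i • a i) = ∑ i, rF.res (d i) • rI.res (a i) := by
    rw [rI.res_sum _ hterm]
    exact Finset.sum_congr rfl fun i _ => hc.res_smul hw (hd1 i) (ha i)
  have hle1 : wI (∑ i, d i • a i) ≤ 1 := wI.map_sum_le hterm
  have h1 : wI (∑ i, d i • a i) = 1 := by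
    refine hle1.eq_of_not_lt fun hlt => ?_
    rw [← rI.res_eq_zero hle1, hres] at hlt
    have := Fintype.linearIndependent_iff.1 hli _ hlt j
    rw [hd] at this
    simp only [inv_mul_cancel₀ h0, rF.res_one] at this
    exact one_ne_zero this
  rw [hsum, map_smul_of_extends wI hw, h1, mul_one]

theorem linearIndependent_of_residue {a : ι → I} (ha : ∀ i, wI (a i) ≤ 1)
    (hli : LinearIndependent Fbar fun i => rI.res (a i)) : LinearIndependent F a := by
  rw [Fintype.linearIndependent_iff]
  intro c h i
  have h1 := map_sum_smul_of_residue_linearIndependent hc hw ha hli c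
  rw [h, map_zero] at h1
  have h2 : v (c i) ≤ 0 := by
    rw [h1]; exact Finset.le_sup (f := fun i => v (c i)) (Finset.mem_univ i)
  simpa using h2

theorem exists_residue_basis [FiniteDimensional F I]
    (hdim : Module.finrank F I = Module.finrank Fbar Ibar) :
    ∃ (b : Module.Basis (Fin (Module.finrank F I)) F I)
      (β : Module.Basis (Fin (Module.finrank F I)) Fbar Ibar),
      ∀ i, wI (b i) ≤ 1 ∧ rI.res (b i) = β i := by
  have hpos : 0 < Module.finrank F I := Module.finrank_pos
  have : Module.Finite Fbar Ibar := Module.finite_of_finrank_pos (hdim ▸ hpos)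
  let β : Module.Basis (Fin (Module.finrank F I)) Fbar Ibar :=
    (Module.finBasis Fbar Ibar).reindex (finCongr hdim.symm)
  choose a ha hra using fun i => rI.exists_res_eq (β i)
  have hli : LinearIndependent Fbar fun i => rI.res (a i) := by
    simp only [hra]; exact β.linearIndependent
  have : Nonempty (Fin (Module.finrank F I)) := ⟨⟨0, hpos⟩⟩
  refine ⟨basisOfLinearIndependentOfCardEqFinrank
    (linearIndependent_of_residue hc hw ha hli) (by simp), β, fun i => ?_⟩
  rw [coe_basisOfLinearIndependentOfCardEqFinrank]
  exact ⟨ha i, hra i⟩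

theorem map_eq_sup_repr {b : Module.Basis ι F I} {β : Module.Basis ι Fbar Ibar}
    (hb : ∀ i, wI (b i) ≤ 1 ∧ rI.res (b i) = β i) (a : I) :
    wI a = Finset.univ.sup fun i => v (b.repr a i) := by
  conv_lhs => rw [← b.sum_repr a]
  refine map_sum_smul_of_residue_linearIndependent hc hw (fun i => (hb i).1) ?_ _
  simp only [(hb _).2]
  exact β.linearIndependent

theorem map_repr_le {b : Module.Basis ι F I} {β : Module.Basis ι Fbar Ibar}
    (hb : ∀ i, wI (b i) ≤ 1 ∧ rI.res (b i) = β i) (a : I) (i : ι) :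
    v (b.repr a i) ≤ wI a := by
  rw [map_eq_sup_repr hc hw hb a]
  exact Finset.le_sup (f := fun i => v (b.repr a i)) (Finset.mem_univ i)

theorem repr_res {b : Module.Basis ι F I} {β : Module.Basis ι Fbar Ibar}
    (hb : ∀ i, wI (b i) ≤ 1 ∧ rI.res (b i) = β i) {a : I} (ha : wI a ≤ 1) (i : ι) :
    β.repr (rI.res a) i = rF.res (b.repr a i) := by
  have h1 : ∀ i, v (b.repr a i) ≤ 1 := fun i => (map_repr_le hc hw hb a i).trans ha
  have : rI.res a = ∑ i, rF.res (b.repr a i) • β i := by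
    conv_lhs => rw [← b.sum_repr a]
    rw [rI.res_sum _ fun i _ => by
      rw [map_smul_of_extends wI hw]; exact mul_le_one' (h1 i) (hb i).1]
    exact Finset.sum_congr rfl fun i _ => by rw [hc.res_smul hw (h1 i) (hb i).1, (hb i).2]
  rw [this, β.repr_sum_self]

end ResidueBasis

end ValuedDivPaper

namespace ValuedDivPaper

open scoped TensorProduct

section Coordinates

variable {K M N ι : Type*} [CommRing K] [AddCommGroup M] [Module K M] [AddCommGroup N] [Module K N]

/-- The coordinates in `N` of an element of `M ⊗ N` with respect to a basis of `M`. -/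
def tensorCoord (b : Module.Basis ι K M) (i : ι) : M ⊗[K] N →ₗ[K] N :=
  (TensorProduct.lid K N).toLinearMap ∘ₗ (b.coord i).rTensor N

@[simp]
theorem tensorCoord_tmul (b : Module.Basis ι K M) (i : ι) (m : M) (x : N) :
    tensorCoord b i (m ⊗ₜ[K] x) = b.repr m i • x := by
  simp [tensorCoord]

theorem sum_tmul_tensorCoord [Fintype ι] (b : Module.Basis ι K M) (x : M ⊗[K] N) :
    ∑ i, b i ⊗ₜ[K] tensorCoord b i x = x := by
  induction x with
  | zero => simp
  | tmul m n =>
    simp only [tensorCoord_tmul]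
    simp_rw [← TensorProduct.smul_tmul, ← TensorProduct.sum_tmul, b.sum_repr]
  | add x y hx hy =>
    simp only [map_add, TensorProduct.tmul_add, Finset.sum_add_distrib, hx, hy]

theorem tensorCoord_sum [Fintype ι] (b : Module.Basis ι K M) (f : ι → N) (i : ι) :
    tensorCoord b i (∑ j, b j ⊗ₜ[K] f j) = f i := by
  classical
  simp [Finsupp.single_apply, ite_smul]

theorem tensorCoord_ext [Fintype ι] (b : Module.Basis ι K M) {x y : M ⊗[K] N}
    (h : ∀ i, tensorCoord b i x = tensorCoord b i y) : x = y := by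
  rw [← sum_tmul_tensorCoord b x, ← sum_tmul_tensorCoord b y]
  simp only [h]

end Coordinates

section CoordinatesMul

variable {K M N ι : Type*} [CommRing K] [Ring M] [Algebra K M] [Ring N] [Algebra K N]

theorem tensorCoord_one_tmul_mul (b : Module.Basis ι K M) (i : ι) (d : N) (x : M ⊗[K] N) :
    tensorCoord b i ((1 ⊗ₜ[K] d) * x) = d * tensorCoord b i x := by
  induction x with
  | zero => simp
  | tmul m n => simp [Algebra.TensorProduct.tmul_mul_tmul]
  | add x y hx hy => simp only [mul_add, map_add, hx, hy]

theorem tensorCoord_mul_one_tmul (b : Module.Basis ι K M) (i : ι) (d : N) (x : M ⊗[K] N) :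
    tensorCoord b i (x * (1 ⊗ₜ[K] d)) = tensorCoord b i x * d := by
  induction x with
  | zero => simp
  | tmul m n => simp [Algebra.TensorProduct.tmul_mul_tmul]
  | add x y hx hy => simp only [add_mul, map_add, hx, hy]

end CoordinatesMul

section TensorGauge

variable {Γ₀ : Type*} [LinearOrderedCommGroupWithZero Γ₀]
  {F : Type*} [Field F] {v : Valuation F Γ₀} {Fbar : Type*} [Field Fbar]
  {rF : ResidueData v Fbar} {I : Type*} [DivisionRing I] [Algebra F I] {wI : Valuation I Γ₀}
  {Ibar : Type*} [DivisionRing Ibar] [Algebra Fbar Ibar] {rI : ResidueData wI Ibar}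
  {ι : Type*} [Fintype ι] {D : Type*} [DivisionRing D] [Algebra F D] {wD : Valuation D Γ₀}
  {Dbar : Type*} [DivisionRing Dbar] [Algebra Fbar Dbar] {rD : ResidueData wD Dbar}
  (b : Module.Basis ι F I) (β : Module.Basis ι Fbar Ibar)

variable (wD) in
/-- The maximum of the values of the coordinates. -/
def tensorValue (x : I ⊗[F] D) : Γ₀ := Finset.univ.sup fun i => wD (tensorCoord b i x)

variable (rD) in
/-- The coordinatewise residue. -/
def tensorResidue (x : I ⊗[F] D) : Ibar ⊗[Fbar] Dbar :=
  ∑ i, β i ⊗ₜ[Fbar] rD.res (tensorCoord b i x)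

theorem tensorValue_le {x : I ⊗[F] D} {t : Γ₀} :
    tensorValue wD b x ≤ t ↔ ∀ i, wD (tensorCoord b i x) ≤ t := by
  simp [tensorValue]

theorem tensorValue_lt {x : I ⊗[F] D} {t : Γ₀} (ht : 0 < t) :
    tensorValue wD b x < t ↔ ∀ i, wD (tensorCoord b i x) < t := by
  rw [tensorValue, Finset.sup_lt_iff (by rwa [bot_eq_zero])]
  simp

theorem tensorCoord_le (x : I ⊗[F] D) (i : ι) : wD (tensorCoord b i x) ≤ tensorValue wD b x :=
  (tensorValue_le b).1 le_rfl i

theorem exists_tensorValue_eq [Nonempty ι] (x : I ⊗[F] D) : ∃ d : D, tensorValue wD b x = wD d := by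
  obtain ⟨j, -, hj⟩ := Finset.exists_mem_eq_sup (Finset.univ : Finset ι)
    Finset.univ_nonempty fun i => wD (tensorCoord b i x)
  exact ⟨_, hj⟩

theorem sup_mul_right (f : ι → Γ₀) (t : Γ₀) :
    (Finset.univ.sup fun i => f i * t) = Finset.univ.sup f * t := by
  refine (Finset.apply_sup_eq_sup_comp_of_linearOrder (fun y => y * t) ?_ ?_).symm
  · exact fun x y h => mul_le_mul_left h t
  · simp [bot_eq_zero]

theorem tensorValue_one_tmul_mul (d : D) (x : I ⊗[F] D) :
    tensorValue wD b ((1 ⊗ₜ[F] d) * x) = wD d * tensorValue wD b x := by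
  simp only [tensorValue, tensorCoord_one_tmul_mul, map_mul]
  rw [mul_comm, ← sup_mul_right]
  simp only [mul_comm]

theorem tensorValue_mul_one_tmul (d : D) (x : I ⊗[F] D) :
    tensorValue wD b (x * (1 ⊗ₜ[F] d)) = tensorValue wD b x * wD d := by
  simp only [tensorValue, tensorCoord_mul_one_tmul, map_mul]
  rw [← sup_mul_right]

theorem tensorValue_add (x y : I ⊗[F] D) :
    tensorValue wD b (x + y) ≤ max (tensorValue wD b x) (tensorValue wD b y) := by
  rw [tensorValue_le]
  intro i
  rw [map_add]
  exact (wD.map_add _ _).trans (max_le_max (tensorCoord_le b x i) (tensorCoord_le b y i))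

theorem tensorValue_sum_le {κ : Type*} (s : Finset κ) (f : κ → I ⊗[F] D) {t : Γ₀}
    (h : ∀ i ∈ s, tensorValue wD b (f i) ≤ t) : tensorValue wD b (∑ i ∈ s, f i) ≤ t := by
  rw [tensorValue_le]
  intro i
  rw [map_sum]
  exact wD.map_sum_le fun j hj => (tensorCoord_le b (f j) i).trans (h j hj)

theorem tensorResidue_add {x y : I ⊗[F] D} (hx : tensorValue wD b x ≤ 1)
    (hy : tensorValue wD b y ≤ 1) : tensorResidue rD b β (x + y) =
      tensorResidue rD b β x + tensorResidue rD b β y := by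
  rw [tensorValue_le] at hx hy
  simp only [tensorResidue, map_add, rD.res_add (hx _) (hy _), TensorProduct.tmul_add,
    Finset.sum_add_distrib]

theorem tensorResidue_sum {κ : Type*} (s : Finset κ) (f : κ → I ⊗[F] D)
    (h : ∀ i ∈ s, tensorValue wD b (f i) ≤ 1) :
    tensorResidue rD b β (∑ i ∈ s, f i) = ∑ i ∈ s, tensorResidue rD b β (f i) := by
  simp only [tensorResidue, map_sum]
  rw [Finset.sum_comm]
  refine Finset.sum_congr rfl fun i _ => ?_
  rw [rD.res_sum _ fun j hj => (tensorCoord_le b (f j) i).trans (h j hj), TensorProduct.tmul_sum]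

variable (hcI : ResCompat v wI rF rI) (hwI : ∀ x : F, wI (algebraMap F I x) = v x)
  (hcD : ResCompat v wD rF rD) (hwD : ∀ x : F, wD (algebraMap F D x) = v x)
  (hb : ∀ i, wI (b i) ≤ 1 ∧ rI.res (b i) = β i)

include hcI hwI hwD hb

theorem tensorValue_tmul (a : I) (d : D) : tensorValue wD b (a ⊗ₜ[F] d) = wI a * wD d := by
  simp only [tensorValue, tensorCoord_tmul, map_smul_of_extends wD hwD]
  rw [sup_mul_right, map_eq_sup_repr hcI hwI hb a]

theorem tensorValue_mul (x y : I ⊗[F] D) :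
    tensorValue wD b (x * y) ≤ tensorValue wD b x * tensorValue wD b y := by
  have key : x * y = ∑ i, ∑ j, (b i * b j) ⊗ₜ[F] (tensorCoord b i x * tensorCoord b j y) := by
    conv_lhs => rw [← sum_tmul_tensorCoord b x, ← sum_tmul_tensorCoord b y]
    rw [Finset.sum_mul_sum]
    simp only [Algebra.TensorProduct.tmul_mul_tmul]
  rw [key]
  refine tensorValue_sum_le b _ _ fun i _ => tensorValue_sum_le b _ _ fun j _ => ?_
  rw [tensorValue_tmul b β hcI hwI hwD hb, map_mul, map_mul]
  calc wI (b i) * wI (b j) * (wD (tensorCoord b i x) * wD (tensorCoord b j y))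
      ≤ 1 * (tensorValue wD b x * tensorValue wD b y) :=
        mul_le_mul' (mul_le_one' (hb i).1 (hb j).1)
          (mul_le_mul' (tensorCoord_le b x i) (tensorCoord_le b y j))
    _ = _ := one_mul _

include hcD

theorem tensorResidue_tmul {a : I} {d : D} (ha : wI a ≤ 1) (hd : wD d ≤ 1) :
    tensorResidue rD b β (a ⊗ₜ[F] d) = rI.res a ⊗ₜ[Fbar] rD.res d := by
  simp only [tensorResidue, tensorCoord_tmul]
  have h : ∀ i, rD.res (b.repr a i • d) = β.repr (rI.res a) i • rD.res d := fun i => by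
    rw [hcD.res_smul hwD ((map_repr_le hcI hwI hb a i).trans ha) hd, repr_res hcI hwI hb ha]
  simp_rw [h, ← TensorProduct.smul_tmul, ← TensorProduct.sum_tmul, β.sum_repr]

theorem tensorResidue_mul {x y : I ⊗[F] D} (hx : tensorValue wD b x ≤ 1)
    (hy : tensorValue wD b y ≤ 1) : tensorResidue rD b β (x * y) =
      tensorResidue rD b β x * tensorResidue rD b β y := by
  have key : x * y = ∑ i, ∑ j, (b i * b j) ⊗ₜ[F] (tensorCoord b i x * tensorCoord b j y) := by
    conv_lhs => rw [← sum_tmul_tensorCoord b x, ← sum_tmul_tensorCoord b y]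
    rw [Finset.sum_mul_sum]
    simp only [Algebra.TensorProduct.tmul_mul_tmul]
  have hx' := (tensorValue_le b).1 hx
  have hy' := (tensorValue_le b).1 hy
  have h1 : ∀ i j, wI (b i * b j) ≤ 1 := fun i j => by
    rw [map_mul]; exact mul_le_one' (hb i).1 (hb j).1
  have h2 : ∀ i j, wD (tensorCoord b i x * tensorCoord b j y) ≤ 1 := fun i j => by
    rw [map_mul]; exact mul_le_one' (hx' i) (hy' j)
  have h3 : ∀ i j, tensorValue wD b
      ((b i * b j) ⊗ₜ[F] (tensorCoord b i x * tensorCoord b j y)) ≤ 1 := fun i j => by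
    rw [tensorValue_tmul b β hcI hwI hwD hb]
    exact mul_le_one' (h1 i j) (h2 i j)
  rw [key, tensorResidue_sum b β _ _ fun i _ => tensorValue_sum_le b _ _ fun j _ => h3 i j]
  simp_rw [tensorResidue_sum b β _ _ fun j _ => h3 _ j,
    tensorResidue_tmul b β hcI hwI hcD hwD hb (h1 _ _) (h2 _ _),
    rI.res_mul (hb _).1 (hb _).1, rD.res_mul (hx' _) (hy' _), (hb _).2,
    ← Algebra.TensorProduct.tmul_mul_tmul]
  rw [← Finset.sum_mul_sum]
  rfl

/-- The gauge on `I ⊗ D` for an inertial `I`. -/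
def tensorGauge : Gauge v (I ⊗[F] D) (Ibar ⊗[Fbar] Dbar) where
  α := tensorValue wD b
  ρ := tensorResidue rD b β
  α_eq_zero := by
    intro x
    constructor
    · intro h
      refine tensorCoord_ext b fun i => ?_
      have := tensorCoord_le (wD := wD) b x i
      rw [h] at this
      simpa using this
    · rintro rfl
      simp [tensorValue]
  α_add := tensorValue_add b
  α_mul := tensorValue_mul b β hcI hwI hwD hb
  α_one := by
    rw [Algebra.TensorProduct.one_def, tensorValue_tmul b β hcI hwI hwD hb, map_one, map_one,
      one_mul]
  α_smul := by
    intro c x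
    simp only [tensorValue, map_smul, map_smul_of_extends wD hwD]
    rw [mul_comm, ← sup_mul_right]
    simp only [mul_comm]
  ρ_add := tensorResidue_add b β
  ρ_mul := tensorResidue_mul b β hcI hwI hcD hwD hb
  ρ_one := by
    rw [Algebra.TensorProduct.one_def, tensorResidue_tmul b β hcI hwI hcD hwD hb (by simp) (by simp),
      rI.res_one, rD.res_one, Algebra.TensorProduct.one_def]
  ρ_eq_zero := by
    intro x hx
    rw [tensorValue_lt b zero_lt_one]
    have hx' := (tensorValue_le b).1 hx
    constructor
    · intro h i
      rw [← rD.res_eq_zero (hx' i), ← tensorCoord_sum β (fun i => rD.res (tensorCoord b i x)) i]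
      change tensorCoord β i (tensorResidue rD b β x) = 0
      rw [h, map_zero]
    · intro h
      refine Finset.sum_eq_zero fun i _ => ?_
      rw [(rD.res_eq_zero (hx' i)).2 (h i), TensorProduct.tmul_zero]
  ρ_surj := by
    intro r
    choose f hf hfr using fun i => rD.exists_res_eq (tensorCoord β i r)
    refine ⟨∑ i, b i ⊗ₜ[F] f i, ?_, ?_⟩
    · rw [tensorValue_le]
      intro i
      rw [tensorCoord_sum]
      exact hf i
    · simp only [tensorResidue, tensorCoord_sum, hfr]
      exact sum_tmul_tensorCoord β r

theorem tensorResidue_algebraMap {c : F} (hv : v c ≤ 1) :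
    tensorResidue rD b β (algebraMap F (I ⊗[F] D) c) =
      algebraMap Fbar (Ibar ⊗[Fbar] Dbar) (rF.res c) := by
  rw [Algebra.TensorProduct.algebraMap_apply, Algebra.TensorProduct.algebraMap_apply,
    tensorResidue_tmul b β hcI hwI hcD hwD hb (by rwa [hwI]) (by simp),
    hcI.res_algebraMap hwI hv, rD.res_one]

end TensorGauge

end ValuedDivPaper

namespace ValuedDivPaper

open scoped TensorProduct

section Simple

variable {K M N ι : Type*} [Field K] [DivisionRing M] [Algebra K M] [DivisionRing N] [Algebra K N]
  [Fintype ι]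

theorem one_mem_of_mem_twoSidedIdeal (b : Module.Basis ι K M)
    (hN : ∀ z : N, (∀ d, d * z = z * d) → ∃ k, algebraMap K N k = z)
    (J : TwoSidedIdeal (M ⊗[K] N)) (n : ℕ) : ∀ x ∈ J, x ≠ 0 →
      Nat.card {i // tensorCoord b i x ≠ 0} ≤ n → (1 : M ⊗[K] N) ∈ J := by
  induction n with
  | zero =>
    intro x _ hx0 hcard
    refine absurd (tensorCoord_ext b fun i => ?_) hx0
    by_contra h
    rw [map_zero] at h
    have : Nonempty {i // tensorCoord b i x ≠ 0} := ⟨⟨i, h⟩⟩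
    have := Nat.card_pos (α := {i // tensorCoord b i x ≠ 0})
    omega
  | succ n ih =>
    intro x hx hx0 hcard
    have : ∃ i, tensorCoord b i x ≠ 0 := by
      by_contra! h
      exact hx0 (tensorCoord_ext b fun i => by rw [h i, map_zero])
    obtain ⟨i0, hi0⟩ := this
    let x' := x * (1 ⊗ₜ[K] (tensorCoord b i0 x)⁻¹)
    have hx'J : x' ∈ J := J.mul_mem_right _ _ hx
    have hcoord : ∀ i, tensorCoord b i x' = tensorCoord b i x * (tensorCoord b i0 x)⁻¹ :=
      fun i => tensorCoord_mul_one_tmul b i _ x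
    clear_value x'
    by_cases hall : ∀ d : N, (1 ⊗ₜ[K] d) * x' - x' * (1 ⊗ₜ[K] d) = 0
    · have hcen : ∀ i, ∃ k, algebraMap K N k = tensorCoord b i x' := fun i => by
        refine hN _ fun d => ?_
        have := congrArg (tensorCoord b i) (hall d)
        rwa [map_sub, tensorCoord_one_tmul_mul, tensorCoord_mul_one_tmul, map_zero,
          sub_eq_zero] at this
      choose k hk using hcen
      have hxm : x' = (∑ i, k i • b i) ⊗ₜ[K] 1 := by
        rw [← sum_tmul_tensorCoord b x', TensorProduct.sum_tmul]
        refine Finset.sum_congr rfl fun i _ => ?_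
        rw [← hk, TensorProduct.smul_tmul, Algebra.algebraMap_eq_smul_one]
      set m := ∑ i, k i • b i
      have hm : m ≠ 0 := by
        intro h
        rw [h, TensorProduct.zero_tmul] at hxm
        have := hcoord i0
        rw [hxm, map_zero, mul_inv_cancel₀ hi0] at this
        exact zero_ne_one this
      have := J.mul_mem_left (m⁻¹ ⊗ₜ[K] 1) _ hx'J
      rwa [hxm, Algebra.TensorProduct.tmul_mul_tmul, inv_mul_cancel₀ hm, one_mul] at this
    · push Not at hall
      obtain ⟨d, hd⟩ := hall
      refine ih _ (J.sub_mem (J.mul_mem_left _ _ hx'J) (J.mul_mem_right _ _ hx'J)) hd ?_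
      refine Nat.le_of_lt_succ (lt_of_lt_of_le ?_ hcard)
      have hsub : {i | tensorCoord b i ((1 ⊗ₜ[K] d) * x' - x' * (1 ⊗ₜ[K] d)) ≠ 0} ⊂
          {i | tensorCoord b i x ≠ 0} := by
        rw [Set.ssubset_iff_of_subset]
        · refine ⟨i0, hi0, ?_⟩
          simp only [Set.mem_ofPred_eq, not_not]
          rw [map_sub, tensorCoord_one_tmul_mul, tensorCoord_mul_one_tmul, hcoord,
            mul_inv_cancel₀ hi0, mul_one, one_mul, sub_self]
        · intro i hi h
          refine hi ?_
          rw [map_sub, tensorCoord_one_tmul_mul, tensorCoord_mul_one_tmul, hcoord, h, zero_mul,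
            mul_zero, zero_mul, sub_self]
      exact Set.ncard_lt_ncard hsub (Set.toFinite _)

/-- The tensor product of a division algebra with a central division algebra is simple. -/
theorem isSimpleRing_tensorProduct [FiniteDimensional K M]
    (hN : ∀ z : N, (∀ d, d * z = z * d) → ∃ k, algebraMap K N k = z) :
    IsSimpleRing (M ⊗[K] N) := by
  have : Nontrivial (M ⊗[K] N) := inferInstance
  refine ⟨{ toNontrivial := inferInstance, eq_bot_or_eq_top := fun J => ?_ }⟩
  by_cases h : ∃ x ∈ J, x ≠ 0
  · obtain ⟨x, hx, hx0⟩ := h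
    right
    have := one_mem_of_mem_twoSidedIdeal (Module.finBasis K M) hN J _ x hx hx0 le_rfl
    exact (TwoSidedIdeal.one_mem_iff J).1 this
  · left
    push Not at h
    exact le_bot_iff.1 fun x hx => (TwoSidedIdeal.mem_bot _).2 (h x hx)

end Simple

theorem eq_zero_or_eq_zero_of_forall_mul_mul {A : Type*} [Ring A] [IsSimpleRing A] {a c : A}
    (h : ∀ x, a * x * c = 0) : a = 0 ∨ c = 0 := by
  let J : TwoSidedIdeal A := TwoSidedIdeal.mk' {y | ∀ x, y * x * c = 0}
    (fun x => by simp)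
    (fun {y z} hy hz x => by rw [add_mul, add_mul, hy x, hz x, add_zero])
    (fun {y} hy x => by rw [neg_mul, neg_mul, hy x, neg_zero])
    (fun {y z} hz x => by rw [mul_assoc y, mul_assoc y, hz x, mul_zero])
    (fun {y z} hy x => by rw [mul_assoc y]; exact hy _)
  have hJ : ∀ y, y ∈ J ↔ ∀ x, y * x * c = 0 := fun y => TwoSidedIdeal.mem_mk' ..
  rcases IsSimpleRing.simple.eq_bot_or_eq_top J with h1 | h1
  · left
    have := (hJ a).2 h
    rwa [h1, TwoSidedIdeal.mem_bot] at this
  · right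
    have : (1 : A) ∈ J := by rw [h1]; trivial
    simpa using (hJ 1).1 this 1

namespace Gauge

variable {F Γ₀ : Type*} [Field F] [LinearOrderedCommGroupWithZero Γ₀]
    {v : Valuation F Γ₀} {A R : Type*} [Ring A] [Algebra F A] [Ring R] (G : Gauge v A R)

include G

/-- If the values of a simple algebra are values of scalars then the residue ring has no
nontrivial central idempotents. -/
theorem central_idempotent [FiniteDimensional F A] [IsSimpleRing A]
    (hhens : HenselianLocalRing v.valuationSubring)
    (hscale : ∀ x, x ≠ 0 → ∃ c : F, v c = G.α x) {s : R} (hs : s * s = s)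
    (hcen : ∀ r, r * s = s * r) : s = 0 ∨ s = 1 := by
  obtain ⟨e, he, he1, rfl⟩ := G.exists_idempotent_lift hhens s hs
  have he' : G.α (1 - e) ≤ 1 := G.α_sub_le G.α_one.le he1
  have hee : (1 - e) * (1 - e) = 1 - e :=
    IsIdempotentElem.one_sub (show IsIdempotentElem e from he)
  by_cases h : ∀ x, e * x * (1 - e) = 0
  · rcases eq_zero_or_eq_zero_of_forall_mul_mul h with h | h
    · left; rw [h, G.ρ_zero]
    · right; rw [← sub_eq_zero.1 h, G.ρ_one]
  · push Not at h
    obtain ⟨x, hx⟩ := h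
    obtain ⟨c, hc⟩ := hscale _ hx
    exfalso
    have hc0 : v c ≠ 0 := by rw [hc]; exact fun h => hx (G.α_eq_zero.1 h)
    set y := c⁻¹ • (e * x * (1 - e)) with hy
    have hy1 : G.α y = 1 := by rw [hy, G.α_smul, ← hc, map_inv₀, inv_mul_cancel₀ hc0]
    have hye : y = e * y * (1 - e) := by
      rw [hy, mul_smul_comm, smul_mul_assoc]
      congr 1
      simp only [← mul_assoc, he]
      rw [mul_assoc (e * x), hee]
    refine G.ρ_ne_zero hy1 ?_
    rw [hye, G.ρ_mul (G.α_mul_le_one he1 hy1.le) he', G.ρ_mul he1 hy1.le, G.ρ_sub G.α_one.le he1,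
      G.ρ_one, ← hcen, mul_assoc, mul_sub, mul_one, hs, sub_self, mul_zero]

end Gauge

end ValuedDivPaper

namespace ValuedDivPaper

open scoped TensorProduct
open Polynomial

/-- Residue data from a total function. -/
def ResidueData.ofFun {Γ₀ : Type*} [LinearOrderedCommGroupWithZero Γ₀] {R Rbar : Type*} [Ring R]
    [Ring Rbar] (w : Valuation R Γ₀) (f : R → Rbar) (h1 : f 1 = 1)
    (hmul : ∀ x y, w x ≤ 1 → w y ≤ 1 → f (x * y) = f x * f y)
    (hadd : ∀ x y, w x ≤ 1 → w y ≤ 1 → f (x + y) = f x + f y)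
    (hsurj : ∀ r, ∃ x, w x ≤ 1 ∧ f x = r) (hzero : ∀ x, w x ≤ 1 → (f x = 0 ↔ w x < 1)) :
    ResidueData w Rbar where
  π := RingHom.mk' ⟨⟨fun x : w.integer => f x, h1⟩, fun x y => hmul _ _ x.2 y.2⟩
    fun x y => hadd _ _ x.2 y.2
  surj r := by
    obtain ⟨x, hx, rfl⟩ := hsurj r
    exact ⟨⟨x, hx⟩, rfl⟩
  ker x := hzero x x.2

theorem exists_geomSum {K B C : Type*} [Field K] [Ring B] [Algebra K B] [Ring C] [Algebra K C]
    {a b : B} (hab : Commute a b) (μ : B →ₗ[K] C) (z : C)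
    (hμ : ∀ i j : ℕ, μ (a ^ i * b ^ j) = z ^ (i + j)) (p : K[X]) :
    ∃ g : B, (∀ r, Commute r a → Commute r b → Commute r g) ∧
      g * (a - b) = aeval a p - aeval b p ∧
      (∀ h : B, (∀ i : ℕ, h * b ^ i = h * a ^ i) → h * g = h * aeval a (derivative p)) ∧
      μ g = aeval z (derivative p) := by
  induction p using Polynomial.induction_on' with
  | add p q hp hq =>
    obtain ⟨g, h1, h2, h3, h4⟩ := hp
    obtain ⟨g', h1', h2', h3', h4'⟩ := hq
    refine ⟨g + g', fun r ha hb => (h1 r ha hb).add_right (h1' r ha hb), ?_, fun h hh => ?_, ?_⟩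
    · rw [add_mul, h2, h2', map_add, map_add]; abel
    · rw [mul_add, h3 h hh, h3' h hh, derivative_add, map_add, mul_add]
    · rw [map_add, h4, h4', derivative_add, map_add]
  | monomial n c =>
    refine ⟨c • ∑ i ∈ Finset.range n, a ^ i * b ^ (n - 1 - i), fun r ha hb => ?_, ?_,
      fun h hh => ?_, ?_⟩
    · exact Commute.smul_right (Commute.sum_right _ _ _ fun i _ =>
        (ha.pow_right i).mul_right (hb.pow_right _)) c
    · rw [smul_mul_assoc, hab.geom_sum₂_mul, aeval_monomial, aeval_monomial, smul_sub,
        Algebra.smul_def, Algebra.smul_def]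
    · rw [derivative_monomial, aeval_monomial, mul_smul_comm, Finset.mul_sum]
      have : ∀ i ∈ Finset.range n, h * (a ^ i * b ^ (n - 1 - i)) = h * a ^ (n - 1) := by
        intro i hi
        rw [(hab.pow_pow _ _).eq, ← mul_assoc, hh, mul_assoc, ← pow_add]
        congr 2
        have := Finset.mem_range.1 hi
        omega
      rw [Finset.sum_congr rfl this, Finset.sum_const, Finset.card_range, map_mul, map_natCast,
        mul_assoc, ← Algebra.smul_def, mul_smul_comm, nsmul_eq_mul, ← mul_assoc, ← mul_assoc,
        (Nat.cast_commute n h).eq]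
    · rw [derivative_monomial, aeval_monomial, map_smul, map_sum]
      have : ∀ i ∈ Finset.range n, μ (a ^ i * b ^ (n - 1 - i)) = z ^ (n - 1) := by
        intro i hi
        rw [hμ]
        congr 1
        have := Finset.mem_range.1 hi
        omega
      rw [Finset.sum_congr rfl this, Finset.sum_const, Finset.card_range, map_mul, map_natCast,
        mul_assoc, ← Algebra.smul_def, nsmul_eq_mul]

theorem exists_separability_idempotent {K B C : Type*} [Field K] [Ring B] [Algebra K B] [Ring C]
    [Algebra K C] [Nontrivial C] {a b : B} (hab : Commute a b) (μ : B →ₗ[K] C) (z : C)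
    (hμ : ∀ i j : ℕ, μ (a ^ i * b ^ j) = z ^ (i + j)) {p : K[X]} (hp : p.Separable)
    (ha : aeval a p = 0) (hb : aeval b p = 0) (hz : aeval z p = 0) :
    ∃ s : B, s * s = s ∧ s ≠ 0 ∧ s * a = s * b ∧
      ∀ r, Commute r a → Commute r b → Commute r s := by
  obtain ⟨g, h1, h2, h3, h4⟩ := exists_geomSum hab μ z hμ p
  rw [ha, hb, sub_self, mul_sub, sub_eq_zero] at h2
  have hpow : ∀ i : ℕ, g * b ^ i = g * a ^ i := fun i => by
    induction i with
    | zero => simp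
    | succ i ih =>
      rw [pow_succ, ← mul_assoc, ih, mul_assoc, (hab.pow_left i).eq, ← mul_assoc, ← h2, mul_assoc,
        pow_succ']
  obtain ⟨u, q, huq⟩ := hp
  have hinv : aeval a (derivative p) * aeval a q = 1 := by
    have := congrArg (aeval a) huq
    rwa [map_add, map_mul, map_mul, ha, mul_zero, zero_add, map_one, ← map_mul, mul_comm q,
      map_mul] at this
  have hgg := h3 g hpow
  have hcom : ∀ r, Commute r a → Commute r b → ∀ f : K[X], Commute r (aeval a f) := by
    intro r hra _ f
    rw [aeval_eq_sum_range]
    exact Commute.sum_right _ _ _ fun i _ => (hra.pow_right i).smul_right _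
  have hga : Commute a g := h1 a (Commute.refl a) hab
  have hgb : Commute b g := h1 b hab.symm (Commute.refl b)
  have hgq : Commute g (aeval a q) := hcom g hga.symm hgb.symm q
  have hqa : Commute (aeval a q) a := (hcom a (Commute.refl a) hab q).symm
  have hqb : Commute (aeval a q) b := by
    rw [aeval_eq_sum_range]
    exact Commute.sum_left _ _ _ fun i _ => (hab.pow_left i).smul_left _
  refine ⟨g * aeval a q, ?_, ?_, ?_, fun r hra hrb => (h1 r hra hrb).mul_right (hcom r hra hrb q)⟩
  · calc g * aeval a q * (g * aeval a q) = g * (aeval a q * g) * aeval a q := by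
          simp only [mul_assoc]
      _ = g * g * aeval a q * aeval a q := by rw [← hgq.eq]; simp only [mul_assoc]
      _ = g * (aeval a (derivative p) * aeval a q) * aeval a q := by
          rw [hgg]; simp only [mul_assoc]
      _ = g * aeval a q := by rw [hinv, mul_one]
  · intro h0
    have hg0 : g = 0 := by
      have h5 : aeval a q * aeval a (derivative p) = 1 := by
        rw [← map_mul, mul_comm, map_mul, hinv]
      rw [← mul_one g, ← h5, ← mul_assoc, h0, zero_mul]
    rw [hg0, map_zero] at h4
    have := congrArg (aeval z) huq
    rw [map_add, map_mul, map_mul, hz, ← h4, mul_zero, mul_zero, add_zero, map_one] at this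
    exact zero_ne_one this
  · rw [mul_assoc, mul_assoc, hqa.eq, hqb.eq, ← mul_assoc, ← mul_assoc, h2]

theorem exists_algebraMap_of_tmul_eq {K M : Type*} [Field K] [DivisionRing M] [Algebra K M]
    {z : M} (h : z ⊗ₜ[K] (1 : Mᵐᵒᵖ) = 1 ⊗ₜ[K] MulOpposite.op z) : ∃ k, algebraMap K M k = z := by
  let b := Module.Basis.ofVectorSpace K M
  have h1 : b.repr 1 ≠ 0 := by simp
  obtain ⟨i, hi⟩ := Finsupp.ne_iff.1 h1
  rw [Finsupp.zero_apply] at hi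
  have := congrArg (tensorCoord b i) h
  rw [tensorCoord_tmul, tensorCoord_tmul, ← MulOpposite.op_one, ← MulOpposite.op_smul,
    ← MulOpposite.op_smul] at this
  have := MulOpposite.op_injective this
  refine ⟨(b.repr 1 i)⁻¹ * b.repr z i, ?_⟩
  rw [Algebra.algebraMap_eq_smul_one, mul_smul, this, smul_smul, inv_mul_cancel₀ hi, one_smul]

section OppositeResidue

open MulOpposite

variable {Γ₀ : Type*} [LinearOrderedCommGroupWithZero Γ₀] {R Rbar : Type*} [Ring R] [Ring Rbar]

/-- A valuation on the opposite ring. -/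
def opValuation (w : Valuation R Γ₀) : Valuation Rᵐᵒᵖ Γ₀ where
  toFun x := w x.unop
  map_zero' := by simp
  map_one' := by simp
  map_mul' x y := by rw [unop_mul, map_mul, mul_comm]
  map_add_le_max' x y := by rw [unop_add]; exact w.map_add _ _

theorem opValuation_apply (w : Valuation R Γ₀) (x : Rᵐᵒᵖ) : opValuation w x = w x.unop := rfl

/-- Residue data on the opposite ring. -/
def opResidueData {w : Valuation R Γ₀} (r : ResidueData w Rbar) :
    ResidueData (opValuation w) Rbarᵐᵒᵖ :=
  ResidueData.ofFun _ (fun x => op (r.res x.unop)) (by simp [r.res_one])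
    (fun x y hx hy => by
      rw [unop_mul, r.res_mul (x := y.unop) (y := x.unop) hy hx, op_mul])
    (fun x y hx hy => by
      rw [unop_add, r.res_add (x := x.unop) (y := y.unop) hx hy, op_add])
    (fun s => by
      obtain ⟨x, hx, h⟩ := r.exists_res_eq s.unop
      exact ⟨op x, hx, by rw [unop_op, h, op_unop]⟩)
    (fun x hx => by
      rw [op_eq_zero_iff, r.res_eq_zero (x := x.unop) hx, opValuation_apply])

end OppositeResidue

/-- The residue algebra of a central inertial division algebra is central. -/
theorem residue_central_of_inertial {Γ₀ : Type*} [LinearOrderedCommGroupWithZero Γ₀]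
    {F : Type*} [Field F] {v : Valuation F Γ₀} (hhens : HenselianLocalRing v.valuationSubring)
    {Fbar : Type*} [Field Fbar] {rF : ResidueData v Fbar}
    {I : Type*} [DivisionRing I] [Algebra F I] [FiniteDimensional F I]
    (hcen : ∀ z : I, (∀ d, d * z = z * d) → ∃ k, algebraMap F I k = z)
    {wI : Valuation I Γ₀} (hwI : ∀ x : F, wI (algebraMap F I x) = v x)
    {Ibar : Type*} [DivisionRing Ibar] [Algebra Fbar Ibar]
    {rI : ResidueData wI Ibar} (hcI : ResCompat v wI rF rI)
    (hdim : Module.finrank F I = Module.finrank Fbar Ibar)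
    (hval : ∀ x : I, x ≠ 0 → ∃ c : F, v c = wI x)
    (hsep : CenterResidueSeparable Fbar Ibar) (z : Ibar) (hz : ∀ d, d * z = z * d) :
    ∃ k, algebraMap Fbar Ibar k = z := by
  obtain ⟨b, β, hb⟩ := exists_residue_basis hcI hwI hdim
  have : Nonempty (Fin (Module.finrank F I)) := ⟨⟨0, Module.finrank_pos⟩⟩
  have hwop : ∀ x : F, opValuation wI (algebraMap F Iᵐᵒᵖ x) = v x := hwI
  have hcop : ResCompat v (opValuation wI) rF (opResidueData rI) := by
    intro x hx hx'
    change MulOpposite.op _ = MulOpposite.op (rI.res (algebraMap F I x))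
    rw [hcI.res_algebraMap hwI hx, rF.res_of_mem hx]
  have : FiniteDimensional F Iᵐᵒᵖ := Module.Finite.equiv (MulOpposite.opLinearEquiv F)
  have : IsSimpleRing (I ⊗[F] Iᵐᵒᵖ) := isSimpleRing_tensorProduct fun z hz => by
    obtain ⟨k, hk⟩ := hcen z.unop fun d => by
      simpa using congrArg MulOpposite.unop (hz (MulOpposite.op d)).symm
    exact ⟨k, MulOpposite.unop_injective hk⟩
  let G := tensorGauge b β hcI hwI hcop hwop hb
  have hscale : ∀ x, x ≠ 0 → ∃ c : F, v c = G.α x := by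
    intro x hx
    obtain ⟨d, hd⟩ := exists_tensorValue_eq (wD := opValuation wI) b x
    have hd0 : d.unop ≠ 0 := by
      intro h
      refine hx (G.α_eq_zero.1 ?_)
      change tensorValue _ b x = 0
      rw [hd, opValuation_apply, h, map_zero]
    obtain ⟨c, hc⟩ := hval _ hd0
    exact ⟨c, hc.trans hd.symm⟩
  obtain ⟨p, -, hps, hpz⟩ := hsep z (Subring.mem_center_iff.2 hz)
  rw [← aeval_def] at hpz
  let μ : Ibar ⊗[Fbar] Ibarᵐᵒᵖ →ₗ[Fbar] Ibar := TensorProduct.lift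
    ((LinearMap.mul Fbar Ibar).compl₂ (MulOpposite.opLinearEquiv Fbar).symm.toLinearMap)
  have hpow : ∀ i j : ℕ, (z ⊗ₜ[Fbar] (1 : Ibarᵐᵒᵖ)) ^ i * (1 ⊗ₜ[Fbar] MulOpposite.op z) ^ j =
      (z ^ i) ⊗ₜ[Fbar] (MulOpposite.op (z ^ j)) := fun i j => by
    rw [Algebra.TensorProduct.tmul_pow, Algebra.TensorProduct.tmul_pow,
      Algebra.TensorProduct.tmul_mul_tmul, one_pow, one_pow, mul_one, one_mul, MulOpposite.op_pow]
  have haz : aeval (z ⊗ₜ[Fbar] (1 : Ibarᵐᵒᵖ)) p = 0 := by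
    have := aeval_algHom_apply (Algebra.TensorProduct.includeLeft :
      Ibar →ₐ[Fbar] Ibar ⊗[Fbar] Ibarᵐᵒᵖ) z p
    rw [hpz, map_zero] at this
    exact this
  have hopz : aeval (MulOpposite.op z) p = 0 := by
    rw [aeval_eq_sum_range] at hpz ⊢
    rw [← MulOpposite.op_zero, ← hpz]
    simp
  have hbz : aeval ((1 : Ibar) ⊗ₜ[Fbar] MulOpposite.op z) p = 0 := by
    have := aeval_algHom_apply (Algebra.TensorProduct.includeRight :
      Ibarᵐᵒᵖ →ₐ[Fbar] Ibar ⊗[Fbar] Ibarᵐᵒᵖ) (MulOpposite.op z) p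
    rw [hopz, map_zero] at this
    exact this
  obtain ⟨s, hss, hs0, hsab, hcom⟩ := exists_separability_idempotent
    (a := z ⊗ₜ[Fbar] (1 : Ibarᵐᵒᵖ)) (b := 1 ⊗ₜ[Fbar] MulOpposite.op z)
    (by
      rw [commute_iff_eq, Algebra.TensorProduct.tmul_mul_tmul, Algebra.TensorProduct.tmul_mul_tmul,
        one_mul, mul_one, one_mul, mul_one])
    μ z (fun i j => by
      rw [hpow]
      change z ^ i * z ^ j = _
      rw [pow_add]) hps haz hbz hpz
  have hcen_s : ∀ r, r * s = s * r := by
    intro r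
    refine hcom r ?_ ?_
    · induction r with
      | zero => exact Commute.zero_left _
      | tmul x y =>
        rw [commute_iff_eq, Algebra.TensorProduct.tmul_mul_tmul,
          Algebra.TensorProduct.tmul_mul_tmul, mul_one, one_mul, hz]
      | add x y hx hy => exact hx.add_left hy
    · induction r with
      | zero => exact Commute.zero_left _
      | tmul x y =>
        rw [commute_iff_eq, Algebra.TensorProduct.tmul_mul_tmul,
          Algebra.TensorProduct.tmul_mul_tmul, mul_one, one_mul]
        congr 1
        exact MulOpposite.unop_injective (hz y.unop).symm
      | add x y hx hy => exact hx.add_left hy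
  rcases G.central_idempotent hhens hscale hss hcen_s with h | h
  · exact absurd h hs0
  · rw [h, one_mul, one_mul] at hsab
    exact exists_algebraMap_of_tmul_eq hsab

end ValuedDivPaper

namespace ValuedDivPaper

namespace Gauge

section Scalars

variable {F Γ₀ : Type*} [Field F] [LinearOrderedCommGroupWithZero Γ₀]
    {v : Valuation F Γ₀} {A A' R R' : Type*} [Ring A] [Algebra F A] [Ring A'] [Algebra F A']
    [Ring R] [Ring R'] (G : Gauge v A R)

/-- Transport of a gauge along isomorphisms. -/
def congr (φ : A' ≃ₐ[F] A) (Φ : R ≃+* R') : Gauge v A' R' where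
  α x := G.α (φ x)
  ρ x := Φ (G.ρ (φ x))
  α_eq_zero := by simp [G.α_eq_zero]
  α_add x y := by rw [map_add]; exact G.α_add _ _
  α_mul x y := by rw [map_mul]; exact G.α_mul _ _
  α_one := by rw [map_one, G.α_one]
  α_smul c x := by rw [map_smul, G.α_smul]
  ρ_add hx hy := by rw [map_add, G.ρ_add hx hy, map_add]
  ρ_mul hx hy := by rw [map_mul, G.ρ_mul hx hy, map_mul]
  ρ_one := by rw [map_one, G.ρ_one, map_one]
  ρ_eq_zero hx := by rw [map_eq_zero_iff Φ Φ.injective, G.ρ_eq_zero hx]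
  ρ_surj r := by
    obtain ⟨x, hx, h⟩ := G.ρ_surj (Φ.symm r)
    exact ⟨φ.symm x, by rwa [φ.apply_symm_apply], by rw [φ.apply_symm_apply, h, Φ.apply_symm_apply]⟩

/-- Every value is the value of a unit which is multiplicative for the gauge. -/
def HasScalars : Prop :=
  ∀ x, x ≠ 0 → ∃ t t' : A, t * t' = 1 ∧ t' * t = 1 ∧ G.α t = G.α x ∧
    (∀ y, G.α (t * y) = G.α x * G.α y) ∧ (∀ y, G.α (y * t) = G.α y * G.α x) ∧
    (∀ y, G.α (t' * y) = (G.α x)⁻¹ * G.α y) ∧ (∀ y, G.α (y * t') = G.α y * (G.α x)⁻¹)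

theorem HasScalars.congr {G : Gauge v A R} (h : G.HasScalars) (φ : A' ≃ₐ[F] A) (Φ : R ≃+* R') :
    (G.congr φ Φ).HasScalars := by
  intro x hx
  obtain ⟨t, t', h1, h2, h3, h4, h5, h6, h7⟩ := h (φ x) (by simpa using hx)
  refine ⟨φ.symm t, φ.symm t', ?_, ?_, ?_, fun y => ?_, fun y => ?_, fun y => ?_, fun y => ?_⟩
  · rw [← map_mul, h1, map_one]
  · rw [← map_mul, h2, map_one]
  · simpa [Gauge.congr] using h3
  · simpa [Gauge.congr] using h4 (φ y)
  · simpa [Gauge.congr] using h5 (φ y)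
  · simpa [Gauge.congr] using h6 (φ y)
  · simpa [Gauge.congr] using h7 (φ y)

end Scalars

section MatrixGauge

open Matrix

variable {F Γ₀ : Type*} [Field F] [LinearOrderedCommGroupWithZero Γ₀]
    {v : Valuation F Γ₀} {ι κ : Type*} [Fintype ι] [DecidableEq ι] [Fintype κ] [DecidableEq κ]
    {D E : Type*} [DivisionRing D] [Algebra F D] [DivisionRing E]

theorem α_ne_zero {A R : Type*} [Ring A] [Algebra F A] [Ring R] (G : Gauge v A R) {x : A}
    (hx : x ≠ 0) : G.α x ≠ 0 := fun h => hx (G.α_eq_zero.1 h)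

section

variable {A : Type*} [Ring A] [Algebra F A] (G : Gauge v A (Matrix κ κ E))

include G

/-- Multiplicativity of a gauge around an idempotent whose residue has rank one. -/
theorem α_mul_of_rank_one (hG : G.HasScalars) {e : A} (he : G.α e ≤ 1) {i : κ}
    (hρ : G.ρ e = single i i 1) {x y : A} (hx : x * e = x) (hy : e * y = y) :
    G.α (x * y) = G.α x * G.α y := by
  rcases eq_or_ne x 0 with rfl | hx0
  · rw [zero_mul, G.α_zero, zero_mul]
  rcases eq_or_ne y 0 with rfl | hy0
  · rw [mul_zero, G.α_zero, mul_zero]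
  obtain ⟨-, t, -, -, -, -, -, h1, -⟩ := hG x hx0
  obtain ⟨-, s, -, -, -, -, -, -, h2⟩ := hG y hy0
  have hx1 : G.α (t * x) = 1 := by rw [h1, inv_mul_cancel₀ (G.α_ne_zero hx0)]
  have hy1 : G.α (y * s) = 1 := by rw [h2, mul_inv_cancel₀ (G.α_ne_zero hy0)]
  have hxe : G.ρ (t * x) = G.ρ (t * x) * single i i 1 := by
    rw [← hρ, ← G.ρ_mul hx1.le he, mul_assoc, hx]
  have hye : G.ρ (y * s) = single i i 1 * G.ρ (y * s) := by
    rw [← hρ, ← G.ρ_mul he hy1.le, ← mul_assoc, hy]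
  obtain ⟨a, ha⟩ : ∃ a, G.ρ (t * x) a i ≠ 0 := by
    by_contra! h
    refine G.ρ_ne_zero hx1 ?_
    rw [hxe]
    ext a b
    rcases eq_or_ne b i with rfl | hb
    · rw [mul_single_apply_same, h, zero_mul, Matrix.zero_apply]
    · rw [mul_single_apply_of_ne _ _ _ _ _ hb, Matrix.zero_apply]
  obtain ⟨b, hb⟩ : ∃ b, G.ρ (y * s) i b ≠ 0 := by
    by_contra! h
    refine G.ρ_ne_zero hy1 ?_
    rw [hye]
    ext a b
    rcases eq_or_ne a i with rfl | ha
    · rw [single_mul_apply_same, h, mul_zero, Matrix.zero_apply]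
    · rw [single_mul_apply_of_ne _ _ _ _ _ ha, Matrix.zero_apply]
  have hprod : G.α (t * x * (y * s)) = 1 := by
    refine G.α_eq_one_of_ρ_ne_zero (G.α_mul_le_one hx1.le hy1.le) fun h => ?_
    rw [G.ρ_mul hx1.le hy1.le, hxe, mul_assoc] at h
    have := congrFun (congrFun h a) b
    rw [Matrix.zero_apply, mul_apply, Finset.sum_eq_single i, single_mul_apply_same, one_mul] at this
    · exact mul_ne_zero ha hb this
    · intro k _ hk
      rw [single_mul_apply_of_ne _ _ _ _ _ hk, mul_zero]
    · simp
  rw [show t * x * (y * s) = t * (x * y * s) by simp only [mul_assoc], h1, h2] at hprod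
  have hx2 := G.α_ne_zero hx0
  have hy2 := G.α_ne_zero hy0
  calc G.α (x * y) = G.α x * ((G.α x)⁻¹ * (G.α (x * y) * (G.α y)⁻¹)) * G.α y := by
        rw [mul_inv_cancel_left₀ hx2, inv_mul_cancel_right₀ hy2]
    _ = _ := by rw [hprod, mul_one]

end

variable (G : Gauge v (Matrix ι ι D) (Matrix κ κ E))

/-- Lift of a rank one idempotent `single i i 1` to a rank one idempotent `p * q`. -/
structure RankOneLift (i : κ) (j : ι) where
  /-- the column -/
  p : Matrix ι ι D
  /-- the row -/
  q : Matrix ι ι D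
  q_mul_p : q * p = single j j 1
  p_mul : p * single j j 1 = p
  mul_q : single j j 1 * q = q
  α_le : G.α (p * q) ≤ 1
  ρ_eq : G.ρ (p * q) = single i i 1

theorem exists_rankOneLift [FiniteDimensional F D] (hhens : HenselianLocalRing v.valuationSubring)
    (hG : G.HasScalars) (i : κ) (j : ι) : Nonempty (RankOneLift G i j) := by
  obtain ⟨e, he, he1, hρ⟩ := G.exists_idempotent_lift hhens (single i i 1) (by simp)
  have he0 : e ≠ 0 := by
    rintro rfl
    rw [G.ρ_zero] at hρ
    have := congrFun (congrFun hρ i) i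
    simp at this
  obtain ⟨a, b, hab⟩ : ∃ a b, e a b ≠ 0 := by
    by_contra! h
    exact he0 (Matrix.ext h)
  set p := e * single b j 1 with hp
  set q := single j a (e a b)⁻¹ * e with hq
  have hqp : q * p = single j j 1 := by
    rw [hp, hq, mul_assoc, ← mul_assoc e, he, ← mul_assoc]
    rw [single_mul_mul_single, inv_mul_cancel₀ hab, mul_one]
  have hps : p * single j j 1 = p := by rw [hp, mul_assoc, single_mul_single_same, mul_one]
  have hsq : single j j 1 * q = q := by rw [hq, ← mul_assoc, single_mul_single_same, one_mul]
  have hep : e * p = p := by rw [hp, ← mul_assoc, he]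
  have hqe : q * e = q := by rw [hq, mul_assoc, he]
  have hidem : (p * q) * (p * q) = p * q := by
    rw [mul_assoc, ← mul_assoc q, hqp, hsq]
  have hpq0 : p * q ≠ 0 := by
    intro h
    have : q * p * (q * p) = 0 := by rw [mul_assoc, ← mul_assoc p, h, zero_mul, mul_zero]
    rw [hqp] at this
    have := congrFun (congrFun this j) j
    simp at this
  have hepq : e = p * q := by
    have h1 : (e - p * q) * (p * q) = 0 := by
      rw [sub_mul, hidem, ← mul_assoc, hep, sub_self]
    have h2 := G.α_mul_of_rank_one hG he1 hρ (x := e - p * q) (y := p * q)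
      (by rw [sub_mul, he, mul_assoc, hqe]) (by rw [← mul_assoc, hep])
    rw [h1, G.α_zero, eq_comm, mul_eq_zero, G.α_eq_zero, G.α_eq_zero] at h2
    exact sub_eq_zero.1 (h2.resolve_right hpq0)
  exact ⟨⟨p, q, hqp, hps, hsq, hepq ▸ he1, hepq ▸ hρ⟩⟩

namespace RankOneLift

variable {G} {i : κ} {j : ι} (l : RankOneLift G i j)

include l

theorem idem_mul_p : l.p * l.q * l.p = l.p := by rw [mul_assoc, l.q_mul_p, l.p_mul]

/-- The embedding of the division ring on the corner. -/
def ψ (d : D) : Matrix ι ι D := l.p * single j j d * l.q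

theorem ψ_one : l.ψ 1 = l.p * l.q := by rw [ψ, l.p_mul]

theorem ψ_mul (d d' : D) : l.ψ (d * d') = l.ψ d * l.ψ d' := by
  rw [ψ, ψ, ψ, show l.p * single j j d * l.q * (l.p * single j j d' * l.q) =
    l.p * (single j j d * (l.q * l.p) * single j j d') * l.q by simp only [mul_assoc], l.q_mul_p,
    single_mul_single_same, single_mul_single_same, mul_one]

theorem ψ_add (d d' : D) : l.ψ (d + d') = l.ψ d + l.ψ d' := by
  rw [ψ, single_add, mul_add, add_mul]; rfl

theorem ψ_algebraMap (c : F) : l.ψ (algebraMap F D c) = c • (l.p * l.q) := by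
  rw [ψ, Algebra.algebraMap_eq_smul_one, ← smul_single, mul_smul_comm, smul_mul_assoc, l.p_mul]

theorem idem_mul_ψ (d : D) : l.p * l.q * l.ψ d = l.ψ d := by
  rw [← ψ_one, ← ψ_mul, one_mul]

theorem ψ_mul_idem (d : D) : l.ψ d * (l.p * l.q) = l.ψ d := by
  rw [← ψ_one, ← ψ_mul, mul_one]

theorem exists_ψ_eq (x : Matrix ι ι D) : ∃ d, l.ψ d = l.p * l.q * x * (l.p * l.q) := by
  refine ⟨(l.q * x * l.p) j j, ?_⟩
  have : single j j ((l.q * x * l.p) j j) = l.q * x * l.p := by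
    have h := single_mul_mul_single j j j j (1 : D) (l.q * x * l.p) 1
    rw [one_mul, mul_one] at h
    rw [← h, mul_assoc, mul_assoc, l.p_mul, ← mul_assoc, ← mul_assoc, l.mul_q]
  rw [ψ, this]
  simp only [mul_assoc]

theorem α_idem : G.α (l.p * l.q) = 1 := by
  refine G.α_eq_one_of_ρ_ne_zero l.α_le fun h => ?_
  rw [l.ρ_eq] at h
  have := congrFun (congrFun h i) i
  simp at this

/-- The valuation obtained by restricting the gauge to the corner. -/
def valuation (hG : G.HasScalars) : Valuation D Γ₀ where
  toFun d := G.α (l.ψ d)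
  map_zero' := by simp [ψ, G.α_zero]
  map_one' := by rw [l.ψ_one, l.α_idem]
  map_mul' d d' := by
    rw [l.ψ_mul]
    exact G.α_mul_of_rank_one hG l.α_le l.ρ_eq (l.ψ_mul_idem d) (l.idem_mul_ψ d')
  map_add_le_max' d d' := by rw [l.ψ_add]; exact G.α_add _ _

theorem α_ψ [FiniteDimensional F D] (hhens : HenselianLocalRing v.valuationSubring)
    (hG : G.HasScalars) (w : Valuation D Γ₀) (hw : ∀ x : F, w (algebraMap F D x) = v x) (d : D) :
    G.α (l.ψ d) = w d := by
  have := valuation_eq_of_extends (l.valuation hG) (v := v) (fun c => by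
    change G.α (l.ψ _) = _
    rw [l.ψ_algebraMap, G.α_smul, l.α_idem, mul_one]) hhens w hw
  rw [← this]
  rfl

/-- The residue map on the corner. -/
def f (d : D) : E := G.ρ (l.ψ d) i i

theorem ρ_ψ {d : D} (hd : G.α (l.ψ d) ≤ 1) : G.ρ (l.ψ d) = single i i (l.f d) := by
  have h := single_mul_mul_single i i i i (1 : E) (G.ρ (l.ψ d)) 1
  rw [one_mul, mul_one] at h
  rw [f, ← h, ← l.ρ_eq, ← G.ρ_mul l.α_le hd, l.idem_mul_ψ, ← G.ρ_mul hd l.α_le, l.ψ_mul_idem]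

/-- The corner of the residue ring as residue division ring. -/
def residueData (w : Valuation D Γ₀) (hw : ∀ d, G.α (l.ψ d) = w d) : ResidueData w E :=
  ResidueData.ofFun w l.f (by rw [f, l.ψ_one, l.ρ_eq, single_apply_same])
    (fun x y hx hy => by
      rw [← hw] at hx hy
      rw [f, l.ψ_mul, G.ρ_mul hx hy, l.ρ_ψ hx, l.ρ_ψ hy, single_mul_single_same,
        single_apply_same])
    (fun x y hx hy => by
      rw [← hw] at hx hy
      rw [f, l.ψ_add, G.ρ_add hx hy]; rfl)
    (fun r => by
      obtain ⟨a, ha, har⟩ := G.ρ_surj (single i i r)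
      obtain ⟨d, hd⟩ := l.exists_ψ_eq a
      refine ⟨d, ?_, ?_⟩
      · rw [← hw, hd]
        exact G.α_mul_le_one (G.α_mul_le_one l.α_le ha) l.α_le
      · rw [f, hd, G.ρ_mul (G.α_mul_le_one l.α_le ha) l.α_le, G.ρ_mul l.α_le ha, l.ρ_eq, har]
        simp)
    (fun x hx => by
      rw [← hw] at hx ⊢
      rw [← G.ρ_eq_zero hx, l.ρ_ψ hx]
      constructor
      · intro h
        rw [h, single_zero]
      · intro h
        have := congrFun (congrFun h i) i
        simpa using this)

theorem f_algebraMap {c : F} (hc : v c ≤ 1) :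
    l.f (algebraMap F D c) = G.ρ (algebraMap F (Matrix ι ι D) c) i i := by
  rw [f, l.ψ_algebraMap, Algebra.smul_def, G.ρ_mul _ l.α_le, l.ρ_eq, mul_single_apply_same,
    mul_one]
  rw [Algebra.algebraMap_eq_smul_one, G.α_smul, G.α_one, mul_one]
  exact hc

theorem valueSet_eq (hG : G.HasScalars) (w : Valuation D Γ₀) (hw : ∀ d, G.α (l.ψ d) = w d) :
    valueSet w = {g | ∃ x, x ≠ 0 ∧ G.α x = g} := by
  ext g
  constructor
  · rintro ⟨d, hd, rfl⟩
    refine ⟨l.ψ d, fun h => ?_, hw d⟩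
    have := hw d
    rw [h, G.α_zero, eq_comm, map_eq_zero] at this
    exact hd this
  · rintro ⟨x, hx, rfl⟩
    obtain ⟨t, t', h1, h2, h3, h4, h5, h6, h7⟩ := hG x hx
    have hx0 := G.α_ne_zero hx
    have he' : G.α (t * (l.p * l.q) * t') = 1 := by
      rw [h7, h4, l.α_idem, mul_one, mul_inv_cancel₀ hx0]
    obtain ⟨a, b, hab⟩ : ∃ a b, G.ρ (t * (l.p * l.q) * t') a b ≠ 0 := by
      by_contra! h
      exact G.ρ_ne_zero he' (Matrix.ext h)
    obtain ⟨y, hy, hyr⟩ := G.ρ_surj (single i a 1)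
    have hey := G.α_mul_le_one l.α_le hy
    have key : G.α (l.p * l.q * y * (t * (l.p * l.q) * t')) = 1 := by
      refine G.α_eq_one_of_ρ_ne_zero (G.α_mul_le_one hey he'.le) fun h => ?_
      rw [G.ρ_mul hey he'.le, G.ρ_mul l.α_le hy, l.ρ_eq, hyr, single_mul_single_same,
        one_mul] at h
      have := congrFun (congrFun h i) b
      rw [single_mul_apply_same, one_mul] at this
      exact hab this
    obtain ⟨d, hd⟩ := l.exists_ψ_eq (y * t)
    rw [show l.p * l.q * y * (t * (l.p * l.q) * t') = l.ψ d * t' by rw [hd]; simp only [mul_assoc],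
      h7, hw] at key
    have hd1 : w d = G.α x := by
      rw [← mul_one (w d), ← inv_mul_cancel₀ hx0, ← mul_assoc, key, one_mul]
    exact ⟨d, fun h => hx0 (by rw [← hd1, h, map_zero]), hd1⟩

end RankOneLift

variable {G}

/-- The size of a matrix ring over a division algebra is determined by its residue ring. -/
theorem card_eq [FiniteDimensional F D] (hG : G.HasScalars) {j : ι}
    (l : ∀ i, RankOneLift G i j) : Fintype.card κ = Fintype.card ι := by
  let L : (κ → D) →ₗ[F] (ι → D) :=
    { toFun := fun Y a => ∑ i, (l i).p a j * Y i
      map_add' := fun Y Z => by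
        ext a
        simp [mul_add, Finset.sum_add_distrib]
      map_smul' := fun c Y => by
        ext a
        simp [Finset.smul_sum] }
  have hL : ∀ Y a b, (∑ i, (l i).p * single j j (Y i)) a b = if b = j then L Y a else 0 := by
    intro Y a b
    rw [Matrix.sum_apply]
    split_ifs with h
    · subst h
      exact Finset.sum_congr rfl fun i _ => mul_single_apply_same ..
    · exact Finset.sum_eq_zero fun i _ => mul_single_apply_of_ne _ _ _ _ _ h _
  have hinj : Function.Injective L := by
    rw [← LinearMap.ker_eq_bot, LinearMap.ker_eq_bot']
    intro Y hY
    have h0 : ∑ i, (l i).p * single j j (Y i) = 0 := by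
      ext a b
      rw [hL, hY]
      simp
    have hy : ∀ i, (l i).p * single j j (Y i) = 0 := by
      by_contra! h
      obtain ⟨i1, hi1⟩ := h
      obtain ⟨i, -, hi⟩ := Finset.exists_max_image Finset.univ
        (fun i => G.α ((l i).p * single j j (Y i))) ⟨i1, Finset.mem_univ _⟩
      have hi0 : (l i).p * single j j (Y i) ≠ 0 := fun h => by
        have := hi i1 (Finset.mem_univ _)
        rw [h, G.α_zero, le_zero_iff, G.α_eq_zero] at this
        exact hi1 this
      have hne := G.α_ne_zero hi0
      obtain ⟨-, t, -, -, -, -, -, -, h7⟩ := hG _ hi0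
      have hle : ∀ k, G.α ((l k).p * single j j (Y k) * t) ≤ 1 := fun k => by
        rw [h7, ← mul_inv_cancel₀ hne]
        exact mul_le_mul_left (hi k (Finset.mem_univ _)) _
      have hone : G.α ((l i).p * single j j (Y i) * t) = 1 := by rw [h7, mul_inv_cancel₀ hne]
      have hk : ∀ k, G.ρ ((l k).p * single j j (Y k) * t) =
          single k k 1 * G.ρ ((l k).p * single j j (Y k) * t) := fun k => by
        rw [← (l k).ρ_eq, ← G.ρ_mul (l k).α_le (hle k), ← mul_assoc, ← mul_assoc,
          (l k).idem_mul_p]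
      have hsum : ∑ k, G.ρ ((l k).p * single j j (Y k) * t) = 0 := by
        rw [← G.ρ_sum _ fun k _ => hle k, ← Finset.sum_mul, h0, zero_mul, G.ρ_zero]
      refine G.ρ_ne_zero hone ?_
      have := congrArg (single i i (1 : E) * ·) hsum
      simp only [Finset.mul_sum, mul_zero] at this
      rw [Finset.sum_eq_single i] at this
      · rwa [← hk] at this
      · intro k _ hki
        rw [hk, ← mul_assoc, single_mul_single_of_ne _ _ _ _ hki.symm, zero_mul]
      · simp
    ext i
    have h1 : single j j (Y i) = 0 := by
      have h2 : single j j (Y i) = single j j 1 * single j j (Y i) := by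
        rw [single_mul_single_same, one_mul]
      rw [h2, ← (l i).q_mul_p, mul_assoc, hy, mul_zero]
    have := congrFun (congrFun h1 j) j
    simpa using this
  have hsurj : Function.Surjective L := by
    intro c
    have hα : G.α (∑ i, (l i).p * (l i).q) ≤ 1 := G.α_sum_le _ fun i _ => (l i).α_le
    obtain ⟨u, hu, -⟩ := G.exists_inverse hα (by
      rw [G.ρ_sum _ fun i _ => (l i).α_le]
      simp only [(l _).ρ_eq]
      ext a b
      rw [Matrix.sum_apply, Matrix.one_apply]
      simp [single_apply, ite_and])
    let C : Matrix ι ι D := Matrix.of fun a b => if b = j then c a else 0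
    have hC : C * single j j 1 = C := by
      ext a b
      rcases eq_or_ne b j with rfl | hb
      · rw [mul_single_apply_same, mul_one]
      · rw [mul_single_apply_of_ne _ _ _ _ _ hb]
        simp [C, hb]
    refine ⟨fun i => ((l i).q * u * C) j j, ?_⟩
    have h1 : ∀ i, single j j (((l i).q * u * C) j j) = (l i).q * u * C := fun i => by
      have h := single_mul_mul_single j j j j (1 : D) ((l i).q * u * C) 1
      rw [one_mul, mul_one] at h
      rw [← h, mul_assoc (single j j 1), mul_assoc _ C, hC, ← mul_assoc, ← mul_assoc, (l i).mul_q]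
    have h2 : ∑ i, (l i).p * single j j (((l i).q * u * C) j j) = C := by
      simp only [h1]
      conv_rhs => rw [← one_mul C, ← hu, Finset.sum_mul, Finset.sum_mul]
      simp only [mul_assoc]
    ext a
    have h3 := hL (fun i => ((l i).q * u * C) j j) a j
    rw [h2, if_pos rfl] at h3
    rw [← h3]
    simp [C]
  have hrank := (LinearEquiv.ofBijective L ⟨hinj, hsurj⟩).finrank_eq
  rw [Module.finrank_pi_fintype, Module.finrank_pi_fintype, Finset.sum_const, Finset.sum_const,
    Finset.card_univ, Finset.card_univ, smul_eq_mul, smul_eq_mul] at hrank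
  exact Nat.eq_of_mul_eq_mul_right Module.finrank_pos hrank

end MatrixGauge

end Gauge

end ValuedDivPaper

namespace ValuedDivPaper

open scoped TensorProduct

/-- Two residue rings of a valued ring are isomorphic. -/
theorem ResidueData.exists_ringEquiv {Γ₀ : Type*} [LinearOrderedCommGroupWithZero Γ₀]
    {R E E' : Type*} [Ring R] [Ring E] [Ring E'] {w : Valuation R Γ₀} (r : ResidueData w E)
    (r' : ResidueData w E') : ∃ φ : E ≃+* E', ∀ x, w x ≤ 1 → φ (r.res x) = r'.res x := by
  have key : ∀ x y, w x ≤ 1 → w y ≤ 1 → (r.res x = r.res y ↔ r'.res x = r'.res y) := by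
    intro x y hx hy
    have hxy : w (x - y) ≤ 1 := (w.map_sub x y).trans (max_le hx hy)
    have h : ∀ {E : Type _} [Ring E] (r : ResidueData w E),
        r.res x = r.res y ↔ w (x - y) < 1 := fun r => by
      rw [← r.res_eq_zero hxy]
      have := r.res_add hxy hy
      rw [sub_add_cancel] at this
      rw [this]
      simp
    rw [h r]
    have h' : r'.res x = r'.res y ↔ w (x - y) < 1 := by
      rw [← r'.res_eq_zero hxy]
      have := r'.res_add hxy hy
      rw [sub_add_cancel] at this
      rw [this]
      simp
    rw [h']
  choose g hg hgr using r.exists_res_eq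
  have hφ : ∀ x, w x ≤ 1 → r'.res (g (r.res x)) = r'.res x := fun x hx =>
    (key _ _ (hg _) hx).1 (hgr _)
  let φ : E →+* E' :=
    { toFun := fun a => r'.res (g a)
      map_one' := by
        rw [← r.res_one, hφ 1 (by simp), r'.res_one]
      map_zero' := by
        rw [← r.res_zero, hφ 0 (by simp), r'.res_zero]
      map_mul' := fun a b => by
        rw [← r'.res_mul (hg _) (hg _), ← hφ (g a * g b), r.res_mul (hg _) (hg _), hgr, hgr]
        rw [map_mul]
        exact mul_le_one' (hg _) (hg _)
      map_add' := fun a b => by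
        rw [← r'.res_add (hg _) (hg _), ← hφ (g a + g b), r.res_add (hg _) (hg _), hgr, hgr]
        exact (w.map_add _ _).trans (max_le (hg _) (hg _)) }
  refine ⟨RingEquiv.ofBijective φ ⟨fun a b hab => ?_, fun c => ?_⟩, hφ⟩
  · rw [← hgr a, ← hgr b]
    exact (key _ _ (hg _) (hg _)).2 hab
  · obtain ⟨x, hx, rfl⟩ := r'.exists_res_eq c
    exact ⟨r.res x, hφ x hx⟩

theorem exists_ringEquiv_of_range_eq {A B M : Type*} [Ring A] [Ring B] [Ring M] {f : A →+* M}
    {g : B →+* M} (hf : Function.Injective f) (hg : Function.Injective g) (h : f.range = g.range) :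
    ∃ φ : A ≃+* B, ∀ a, g (φ a) = f a := by
  let e1 : A ≃+* f.range := RingEquiv.ofBijective f.rangeRestrict
    ⟨fun a b hab => hf (congrArg Subtype.val hab), f.rangeRestrict_surjective⟩
  let e2 : B ≃+* g.range := RingEquiv.ofBijective g.rangeRestrict
    ⟨fun a b hab => hg (congrArg Subtype.val hab), g.rangeRestrict_surjective⟩
  refine ⟨(e1.trans (RingEquiv.subringCongr h)).trans e2.symm, fun a => ?_⟩
  have : e2 (e2.symm (RingEquiv.subringCongr h (e1 a))) = RingEquiv.subringCongr h (e1 a) :=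
    e2.apply_symm_apply _
  exact congrArg Subtype.val this

/-- The center of the tensor product with a central division algebra. -/
theorem exists_tmul_one_of_central {K M N : Type*} [Field K] [DivisionRing M] [Algebra K M]
    [DivisionRing N] [Algebra K N] [FiniteDimensional K M]
    (hN : ∀ z : N, (∀ d, d * z = z * d) → ∃ k, algebraMap K N k = z) {x : M ⊗[K] N}
    (hx : ∀ y, y * x = x * y) : ∃ m ∈ Subring.center M, x = m ⊗ₜ[K] 1 := by
  let b := Module.finBasis K M
  have : ∀ i, ∃ k, algebraMap K N k = tensorCoord b i x := fun i => hN _ fun d => by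
    have := congrArg (tensorCoord b i) (hx (1 ⊗ₜ d))
    rwa [tensorCoord_one_tmul_mul, tensorCoord_mul_one_tmul] at this
  choose k hk using this
  have hxm : x = (∑ i, k i • b i) ⊗ₜ[K] 1 := by
    rw [← sum_tmul_tensorCoord b x, TensorProduct.sum_tmul]
    refine Finset.sum_congr rfl fun i _ => ?_
    rw [← hk, TensorProduct.smul_tmul, Algebra.algebraMap_eq_smul_one]
  refine ⟨_, Subring.mem_center_iff.2 fun d => ?_, hxm⟩
  have h1 := hx (d ⊗ₜ[K] 1)
  rw [hxm, Algebra.TensorProduct.tmul_mul_tmul, Algebra.TensorProduct.tmul_mul_tmul] at h1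
  exact Algebra.TensorProduct.includeLeft_injective (S := K) (R := K) (A := M) (B := N)
    (algebraMap K N).injective (by simpa using h1)

theorem center_equiv_of_matrix_equiv {K M N E : Type*} [Field K] [DivisionRing M] [Algebra K M]
    [DivisionRing N] [Algebra K N] [DivisionRing E] [Algebra K E] [FiniteDimensional K M]
    (hN : ∀ z : N, (∀ d, d * z = z * d) → ∃ k, algebraMap K N k = z) {n : ℕ} (hn : 0 < n)
    (Φ : M ⊗[K] N ≃ₐ[K] Matrix (Fin n) (Fin n) E) :
    ∃ φ : Subring.center E ≃+* Subring.center M,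
      ∀ (a : K) (h1 : algebraMap K E a ∈ Subring.center E)
        (h2 : algebraMap K M a ∈ Subring.center M),
        φ ⟨algebraMap K E a, h1⟩ = ⟨algebraMap K M a, h2⟩ := by
  have : Nonempty (Fin n) := ⟨⟨0, hn⟩⟩
  let f : Subring.center E →+* Matrix (Fin n) (Fin n) E :=
    (Matrix.scalar (Fin n)).comp (Subring.center E).subtype
  let ι : M →ₐ[K] M ⊗[K] N := Algebra.TensorProduct.includeLeft
  let g : Subring.center M →+* Matrix (Fin n) (Fin n) E :=
    ((Φ : M ⊗[K] N →+* _).comp (ι : M →+* M ⊗[K] N)).comp (Subring.center M).subtype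
  have hf : Function.Injective f := fun a b h => Subtype.ext (Matrix.scalar_inj.1 h)
  have hι : Function.Injective ι :=
    Algebra.TensorProduct.includeLeft_injective (algebraMap K N).injective
  have hg : Function.Injective g := (Φ.injective.comp hι).comp Subtype.val_injective
  have hfr : f.range = Subring.center _ := by
    rw [Matrix.subringCenter_eq_scalar_map, RingHom.range_eq_map, ← Subring.map_map,
      ← RingHom.range_eq_map, Subring.range_subtype]
  have hgr : g.range = Subring.center _ := by
    ext y
    constructor
    · rintro ⟨m, rfl⟩
      rw [Subring.mem_center_iff]
      intro y
      obtain ⟨x, rfl⟩ := Φ.surjective y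
      change Φ x * Φ ((m : M) ⊗ₜ 1) = Φ ((m : M) ⊗ₜ 1) * Φ x
      rw [← map_mul, ← map_mul]
      congr 1
      induction x with
      | zero => simp
      | tmul a d =>
        rw [Algebra.TensorProduct.tmul_mul_tmul, Algebra.TensorProduct.tmul_mul_tmul, one_mul,
          mul_one, Subring.mem_center_iff.1 m.2]
      | add x y hx hy => rw [add_mul, mul_add, hx, hy]
    · intro hy
      obtain ⟨m, hm, hmx⟩ := exists_tmul_one_of_central hN (x := Φ.symm y) fun x => by
        apply Φ.injective
        rw [map_mul, map_mul, Φ.apply_symm_apply]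
        exact Subring.mem_center_iff.1 hy _
      refine ⟨⟨m, hm⟩, ?_⟩
      change Φ (m ⊗ₜ 1) = y
      rw [← hmx, Φ.apply_symm_apply]
  obtain ⟨φ, hφ⟩ := exists_ringEquiv_of_range_eq hf hg (hfr.trans hgr.symm)
  refine ⟨φ, fun a h1 h2 => hg ?_⟩
  rw [hφ]
  change Matrix.scalar (Fin n) (algebraMap K E a) = Φ (ι (algebraMap K M a))
  rw [AlgHom.commutes, AlgEquiv.commutes]
  rfl

theorem finrank_center_mul {K M : Type*} [Field K] [DivisionRing M] [Algebra K M] :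
    Module.finrank K (Subalgebra.center K M) * dimOver (Subring.center M) = Module.finrank K M :=
  have : Module.Free (Subalgebra.center K M) M :=
    (inferInstance : Module.Free (Subring.center M) M)
  Module.finrank_mul_finrank K (Subalgebra.center K M) M

theorem finrank_center_eq {K M E : Type*} [Field K] [DivisionRing M] [Algebra K M]
    [DivisionRing E] [Algebra K E] (φ : Subring.center E ≃+* Subring.center M)
    (hφ : ∀ (a : K) (h1 : algebraMap K E a ∈ Subring.center E)
        (h2 : algebraMap K M a ∈ Subring.center M),
        φ ⟨algebraMap K E a, h1⟩ = ⟨algebraMap K M a, h2⟩) :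
    Module.finrank K (Subalgebra.center K E) = Module.finrank K (Subalgebra.center K M) := by
  let ψ : Subalgebra.center K E ≃ₐ[K] Subalgebra.center K M :=
    AlgEquiv.ofRingEquiv (f := (φ : Subalgebra.center K E ≃+* Subalgebra.center K M))
      fun a => hφ a _ (Subalgebra.algebraMap_mem (Subalgebra.center K M) a)
  exact ψ.toLinearEquiv.finrank_eq

section Inertial

variable {Γ₀ : Type*} [LinearOrderedCommGroupWithZero Γ₀]
  {F : Type*} [Field F] {v : Valuation F Γ₀} {Fbar : Type*} [Field Fbar]
  {I : Type*} [DivisionRing I] [Algebra F I] {wI : Valuation I Γ₀}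
  {Ibar : Type*} [DivisionRing Ibar] [Algebra Fbar Ibar] {rI : ResidueData wI Ibar}

theorem IsInertial.finrank_eq (h : IsInertial F wI Fbar rI) :
    Module.finrank F I = Module.finrank Fbar Ibar := by
  obtain ⟨⟨h1, -, -⟩, h2⟩ := h
  rw [h1, h2]
  have : mulSetIndex (valueSetOn wI (algebraMap F I).range)
      (valueSetOn wI (algebraMap F I).range) = 1 := by
    rw [mulSetIndex, Nat.card_eq_one_iff_unique]
    refine ⟨⟨fun x y => ?_⟩, ⟨Quot.mk _ ⟨1, 1, one_mem _, one_ne_zero, map_one _⟩⟩⟩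
    induction x using Quot.ind with | mk x => ?_
    induction y using Quot.ind with | mk y => ?_
    obtain ⟨_, a, ha, ha0, rfl⟩ := x
    obtain ⟨_, c, hc, hc0, rfl⟩ := y
    refine Quot.sound ⟨wI (c⁻¹ * a), ⟨c⁻¹ * a, ?_, mul_ne_zero (inv_ne_zero hc0) ha0, rfl⟩, ?_⟩
    · obtain ⟨k, rfl⟩ := hc
      exact mul_mem ⟨k⁻¹, map_inv₀ _ _⟩ ha
    · change wI a = wI c * _
      rw [← map_mul, mul_inv_cancel_left₀ hc0]
  rw [this, mul_one]

theorem IsInertial.exists_eq (h : IsInertial F wI Fbar rI)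
    (hwI : ∀ x : F, wI (algebraMap F I x) = v x) {x : I} (hx : x ≠ 0) : ∃ c : F, v c = wI x := by
  have h1 : wI x ∈ valueSet wI := ⟨x, hx, rfl⟩
  rw [h.2] at h1
  obtain ⟨_, ⟨c, rfl⟩, -, hc⟩ := h1
  exact ⟨c, by rw [← hwI, hc]⟩

end Inertial

theorem exists_algebraMap_of_center_eq_bot {F I : Type*} [Field F] [DivisionRing I] [Algebra F I]
    (h : Subalgebra.center F I = ⊥) (z : I) (hz : ∀ d, d * z = z * d) :
    ∃ k, algebraMap F I k = z := by
  have : z ∈ Subalgebra.center F I := Subalgebra.mem_center_iff.2 hz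
  rwa [h, Algebra.mem_bot] at this

end ValuedDivPaper

namespace ValuedDivPaper

open scoped TensorProduct

theorem hasScalars_of_tensorValue {Γ₀ : Type*} [LinearOrderedCommGroupWithZero Γ₀]
    {F : Type*} [Field F] {v : Valuation F Γ₀} {I D R ι : Type*} [DivisionRing I] [Algebra F I]
    [DivisionRing D] [Algebra F D] [Ring R] [Fintype ι] [Nonempty ι] {wD : Valuation D Γ₀}
    (b : Module.Basis ι F I) (G : Gauge v (I ⊗[F] D) R) (hG : G.α = tensorValue wD b) :
    G.HasScalars := by
  intro x hx
  obtain ⟨d, hd⟩ := exists_tensorValue_eq (wD := wD) b x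
  rw [← hG] at hd
  have hd0 : d ≠ 0 := by
    rintro rfl
    exact G.α_ne_zero hx (by rw [hd, map_zero])
  have h1 : G.α (1 ⊗ₜ d) = wD d := by
    have := tensorValue_one_tmul_mul (wD := wD) b d 1
    rwa [mul_one, ← hG, G.α_one, mul_one] at this
  refine ⟨1 ⊗ₜ d, 1 ⊗ₜ d⁻¹, ?_, ?_, ?_, fun y => ?_, fun y => ?_, fun y => ?_, fun y => ?_⟩
  · rw [Algebra.TensorProduct.tmul_mul_tmul, one_mul, mul_inv_cancel₀ hd0,
      Algebra.TensorProduct.one_def]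
  · rw [Algebra.TensorProduct.tmul_mul_tmul, one_mul, inv_mul_cancel₀ hd0,
      Algebra.TensorProduct.one_def]
  · rw [h1, hd]
  · rw [hd, hG, tensorValue_one_tmul_mul]
  · rw [hd, hG, tensorValue_mul_one_tmul]
  · rw [hd, hG, tensorValue_one_tmul_mul, map_inv₀]
  · rw [hd, hG, tensorValue_mul_one_tmul, map_inv₀]

/-- The residue algebra of a matrix algebra over a division algebra with respect to a gauge. -/
theorem Gauge.exists_residue_algEquiv {Γ₀ : Type*} [LinearOrderedCommGroupWithZero Γ₀]
    {F : Type*} [Field F] {v : Valuation F Γ₀} (hhens : HenselianLocalRing v.valuationSubring)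
    {Fbar : Type*} [Field Fbar] {rF : ResidueData v Fbar}
    {A R : Type*} [Ring A] [Algebra F A] [Ring R] [Algebra Fbar R] [Module.Finite Fbar R]
    [IsSimpleRing R] (G : Gauge v A R) (hG : G.HasScalars)
    (hρ : ∀ c : F, v c ≤ 1 → G.ρ (algebraMap F A c) = algebraMap Fbar R (rF.res c))
    {D' : Type*} [DivisionRing D'] [Algebra F D'] [FiniteDimensional F D']
    {n : ℕ} (hn : 0 < n) (e : A ≃ₐ[F] Matrix (Fin n) (Fin n) D')
    {wD' : Valuation D' Γ₀} (hwD' : ∀ x : F, wD' (algebraMap F D' x) = v x)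
    {D'bar : Type*} [DivisionRing D'bar] [Algebra Fbar D'bar]
    {rD' : ResidueData wD' D'bar} (hcompatD' : ResCompat v wD' rF rD') :
    valueSet wD' = {g | ∃ x, x ≠ 0 ∧ G.α x = g} ∧
      Nonempty (R ≃ₐ[Fbar] Matrix (Fin n) (Fin n) D'bar) := by
  have : IsArtinianRing R := IsArtinianRing.of_finite Fbar R
  obtain ⟨r, hr, E, _, _, _, ⟨Φ⟩⟩ := IsSimpleRing.exists_algEquiv_matrix_divisionRing_finite Fbar R
  let H : Gauge v (Matrix (Fin n) (Fin n) D') (Matrix (Fin r) (Fin r) E) := G.congr e.symm Φ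
  have hH : H.HasScalars := hG.congr e.symm (Φ : R ≃+* Matrix (Fin r) (Fin r) E)
  let j : Fin n := ⟨0, hn⟩
  let l := fun i => (H.exists_rankOneLift hhens hH i j).some
  have hα := (l 0).α_ψ hhens hH wD' hwD'
  obtain ⟨φ, hφ⟩ := ((l 0).residueData wD' hα).exists_ringEquiv rD'
  have hres : ∀ c : F, v c ≤ 1 →
      φ (algebraMap Fbar E (rF.res c)) = algebraMap Fbar D'bar (rF.res c) := by
    intro c hc
    have hc' : wD' (algebraMap F D' c) ≤ 1 := by rwa [hwD']
    rw [← hcompatD'.res_algebraMap hwD' hc, ← hφ _ hc', ResidueData.res_of_mem _ hc']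
    change _ = φ ((l 0).f (algebraMap F D' c))
    rw [(l 0).f_algebraMap hc]
    congr 1
    change _ = Φ (G.ρ (e.symm (algebraMap F _ c))) 0 0
    rw [AlgEquiv.commutes, hρ c hc, AlgEquiv.commutes, Matrix.algebraMap_matrix_apply, if_pos rfl]
  let ψ : E ≃ₐ[Fbar] D'bar := AlgEquiv.ofRingEquiv (f := φ) fun a => by
    obtain ⟨c, hc, rfl⟩ := rF.exists_res_eq a
    exact hres c hc
  have hcard := Gauge.card_eq hH l
  rw [Fintype.card_fin, Fintype.card_fin] at hcard
  subst hcard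
  refine ⟨?_, ⟨Φ.trans ψ.mapMatrix⟩⟩
  rw [(l 0).valueSet_eq hH wD' hα]
  ext g
  constructor
  · rintro ⟨x, hx, rfl⟩
    exact ⟨e.symm x, by simpa using hx, rfl⟩
  · rintro ⟨x, hx, rfl⟩
    refine ⟨e x, by simpa using hx, ?_⟩
    change G.α (e.symm (e x)) = _
    rw [e.symm_apply_apply]

end ValuedDivPaper

namespace ValuedDivPaper

/-- for `I` inertial and `D` tame central division algebras over a
Henselian field `F`, with `D'` the division algebra underlying `I ⊗_F D`:
`Z(D̄') ≅ Z(D̄)` over `F̄`, `Γ_{D'} = Γ_D`, `[D̄'] = [Ī ⊗_F̄ D̄]` in `Br(Z(D̄))`, and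
`deg D / deg D̄ = deg D' / deg D̄'`. -/
theorem stmt_16 {Γ₀ : Type*} [LinearOrderedCommGroupWithZero Γ₀]
    {F : Type*} [Field F] (v : Valuation F Γ₀)
    (hhens : HenselianLocalRing v.valuationSubring)
    {Fbar : Type*} [Field Fbar] (rF : ResidueData v Fbar)
    -- the inertial division algebra I
    {I : Type*} [DivisionRing I] [Algebra F I] [FiniteDimensional F I]
    (hcenI : Subalgebra.center F I = ⊥)
    (wI : Valuation I Γ₀) (hwI : ∀ x : F, wI (algebraMap F I x) = v x)
    {Ibar : Type*} [DivisionRing Ibar] [Algebra Fbar Ibar]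
    (rI : ResidueData wI Ibar) (hcompatI : ResCompat v wI rF rI)
    (hinertial : IsInertial F wI Fbar rI)
    -- the tame division algebra D
    {D : Type*} [DivisionRing D] [Algebra F D] [FiniteDimensional F D]
    (hcenD : Subalgebra.center F D = ⊥)
    (wD : Valuation D Γ₀) (hwD : ∀ x : F, wD (algebraMap F D x) = v x)
    {Dbar : Type*} [DivisionRing Dbar] [Algebra Fbar Dbar]
    (rD : ResidueData wD Dbar) (hcompatD : ResCompat v wD rF rD)
    (htameD : IsTame F wD Fbar rD)
    -- D' : the division algebra underlying [I ⊗_F D]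
    {D' : Type*} [DivisionRing D'] [Algebra F D'] [FiniteDimensional F D']
    (hcenD' : Subalgebra.center F D' = ⊥)
    (n : ℕ) (hn : 0 < n)
    (e : TensorProduct F I D ≃ₐ[F] Matrix (Fin n) (Fin n) D')
    (wD' : Valuation D' Γ₀) (hwD' : ∀ x : F, wD' (algebraMap F D' x) = v x)
    {D'bar : Type*} [DivisionRing D'bar] [Algebra Fbar D'bar]
    (rD' : ResidueData wD' D'bar) (hcompatD' : ResCompat v wD' rF rD') :
    -- Z(D̄') ≅ Z(D̄) over F̄
    (∃ φ : Subring.center D'bar ≃+* Subring.center Dbar,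
      ∀ (a : Fbar) (h1 : algebraMap Fbar D'bar a ∈ Subring.center D'bar)
        (h2 : algebraMap Fbar Dbar a ∈ Subring.center Dbar),
        φ ⟨algebraMap Fbar D'bar a, h1⟩ = ⟨algebraMap Fbar Dbar a, h2⟩) ∧
    -- Γ_{D'} = Γ_D
    valueSet wD' = valueSet wD ∧
    -- [D̄'] = [Ī ⊗_F̄ D̄] in Br(Z(D̄)) (Brauer equivalence, via matrix rings)
    (∃ k m : ℕ, 0 < k ∧ 0 < m ∧
      Nonempty
        (Matrix (Fin k) (Fin k) (TensorProduct Fbar Ibar Dbar) ≃+*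
          Matrix (Fin m) (Fin m) D'bar)) ∧
    -- deg D / deg D̄ = deg D' / deg D̄'  (squared, cross-multiplied)
    Module.finrank F D * dimOver (Subring.center D'bar) =
      Module.finrank F D' * dimOver (Subring.center Dbar) := by
  have hdim := hinertial.finrank_eq
  have hcenIbar := residue_central_of_inertial hhens
    (exists_algebraMap_of_center_eq_bot hcenI) hwI hcompatI hdim
    (fun x hx => hinertial.exists_eq hwI hx) hinertial.1.2.1
  have hposI : 0 < Module.finrank F I := Module.finrank_pos
  have : Module.Finite Fbar Ibar := Module.finite_of_finrank_pos (hdim ▸ hposI)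
  have : Module.Finite Fbar Dbar := Module.finite_of_finrank_pos <| Nat.pos_of_ne_zero fun h => by
    have h1 : 0 < Module.finrank F D := Module.finrank_pos
    rw [htameD.1, h, zero_mul] at h1
    exact h1.false
  have : Nonempty (Fin (Module.finrank F I)) := ⟨⟨0, hposI⟩⟩
  obtain ⟨b, β, hb⟩ := exists_residue_basis hcompatI hwI hdim
  have : IsSimpleRing (TensorProduct Fbar Dbar Ibar) := isSimpleRing_tensorProduct hcenIbar
  have : IsSimpleRing (TensorProduct Fbar Ibar Dbar) :=
    IsSimpleRing.of_ringEquiv (Algebra.TensorProduct.comm Fbar Dbar Ibar).toRingEquiv this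
  let G := tensorGauge b β hcompatI hwI hcompatD hwD hb
  obtain ⟨hval, ⟨Φ⟩⟩ := G.exists_residue_algEquiv hhens (hasScalars_of_tensorValue b G rfl)
    (fun c hc => tensorResidue_algebraMap b β hcompatI hwI hcompatD hwD hb hc) hn e hwD' hcompatD'
  obtain ⟨φ, hφ⟩ := center_equiv_of_matrix_equiv hcenIbar hn
    ((Algebra.TensorProduct.comm Fbar Dbar Ibar).trans Φ)
  refine ⟨⟨φ, hφ⟩, ?_, ⟨1, n, one_pos, hn, ⟨Matrix.uniqueRingEquiv.trans Φ.toRingEquiv⟩⟩, ?_⟩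
  · rw [hval]
    ext g
    constructor
    · rintro ⟨x, hx, rfl⟩
      obtain ⟨d, hd⟩ := exists_tensorValue_eq (wD := wD) b x
      refine ⟨d, ?_, hd.symm⟩
      rintro rfl
      exact G.α_ne_zero hx (hd.trans (map_zero wD))
    · rintro ⟨d, hd, rfl⟩
      have h1 : G.α (TensorProduct.tmul F 1 d) = wD d :=
        (tensorValue_tmul b β hcompatI hwI hwD hb 1 d).trans (by rw [map_one, one_mul])
      refine ⟨TensorProduct.tmul F 1 d, fun h => ?_, h1⟩
      rw [h, G.α_zero, eq_comm, map_eq_zero] at h1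
      exact hd h1
  · have h1 : Module.finrank F I * Module.finrank F D = n * n * Module.finrank F D' := by
      rw [← Module.finrank_tensorProduct, e.toLinearEquiv.finrank_eq, Module.finrank_matrix,
        Fintype.card_fin]
    have h2 : Module.finrank F I * Module.finrank Fbar Dbar =
        n * n * Module.finrank Fbar D'bar := by
      rw [hdim, ← Module.finrank_tensorProduct, Φ.toLinearEquiv.finrank_eq, Module.finrank_matrix,
        Fintype.card_fin]
    have h3 := finrank_center_mul (K := Fbar) (M := Dbar)
    have h4 := finrank_center_mul (K := Fbar) (M := D'bar)
    rw [finrank_center_eq φ hφ] at h4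
    have hz : 0 < Module.finrank Fbar (Subalgebra.center Fbar Dbar) := Module.finrank_pos
    refine Nat.eq_of_mul_eq_mul_left (Nat.mul_pos (Nat.mul_pos hposI (Nat.mul_pos hn hn)) hz) ?_
    rw [← h3, ← h4] at h2
    calc _ = (Module.finrank F I * Module.finrank F D) * (n * n *
          (Module.finrank Fbar (Subalgebra.center Fbar Dbar) *
            dimOver (Subring.center D'bar))) := by ring
      _ = n * n * Module.finrank F D' * (Module.finrank F I *
          (Module.finrank Fbar (Subalgebra.center Fbar Dbar) *
            dimOver (Subring.center Dbar))) := by rw [h1, h2]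
      _ = _ := by ring

end ValuedDivPaper
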